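/- Let x be a chain-point for the chain V_0 ⊊ V_1 ⊊ … ⊊ V_k, and let λ := 2 − max_{i=0,…,k} x(δ(V_i)). Then there exist y ∈ Sp_𝒞(G) (the convex hull of characteristic vectors of Gao-trees) and x' ∈ Sp(G) (the spanning tree polytope) such that x = λ·y + (1−λ)·x'. -/

import Mathlib

open Finset
open scoped Classical

variable {V : Type*} [Fintype V]

/-- The set of edges of `G` with one endpoint in `S₁` and the other in `S₂`. -/
noncomputable def cutBetween (G : SimpleGraph V) (S₁ S₂ : Finset V) : Finset (Sym2 V) :=
  G.edgeFinset.filter (fun e => ∃ u v, e = s(u, v) ∧ u ∈ S₁ ∧ v ∈ S₂)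

/-- The cut `δ(S)`: edges of `G` with exactly one endpoint in `S`. -/
noncomputable def cut (G : SimpleGraph V) (S : Finset V) : Finset (Sym2 V) :=
  cutBetween G S Sᶜ

/-- `E(S)`: edges of `G` with both endpoints in `S`. -/
noncomputable def inducedEdges (G : SimpleGraph V) (S : Finset V) : Finset (Sym2 V) :=
  G.edgeFinset.filter (fun e => ∀ v ∈ e, v ∈ S)

/-- `T` is the edge set of a spanning tree of `G`. -/
def IsSpanningTree (G : SimpleGraph V) (T : Finset (Sym2 V)) : Prop :=
  (T : Set (Sym2 V)) ⊆ G.edgeSet ∧ (SimpleGraph.fromEdgeSet (T : Set (Sym2 V))).IsTree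

/-- Characteristic vector of a set of edges. -/
noncomputable def chi (T : Finset (Sym2 V)) : Sym2 V → ℝ :=
  fun e => if e ∈ T then 1 else 0

/-- The spanning tree polytope `Sp(G)`. -/
noncomputable def spanningTreePolytope (G : SimpleGraph V) : Set (Sym2 V → ℝ) :=
  convexHull ℝ {x | ∃ T : Finset (Sym2 V), IsSpanningTree G T ∧ x = chi T}

/-- The level sets `L_i = V_i \ V_{i-1}` of a chain `V_0 ⊊ … ⊊ V_k` (with `V_{-1} = ∅`,
`V_{k+1} = V`). -/
noncomputable def level (Vc : ℕ → Finset V) (k : ℕ) : ℕ → Finset V :=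
  fun i => if i = 0 then Vc 0 else if i ≤ k then Vc i \ Vc (i - 1) else Finset.univ \ Vc k

/-- `x` is a chain-point for the chain `V_0 ⊊ … ⊊ V_k`. -/
def IsChainPoint (G : SimpleGraph V) (Vc : ℕ → Finset V) (k : ℕ) (x : Sym2 V → ℝ) : Prop :=
  x ∈ spanningTreePolytope G ∧
  (∑ e ∈ cut G (Vc 0), x e) = 1 ∧
  (∑ e ∈ cut G (Vc k), x e) = 1 ∧
  (∀ i, 1 ≤ i → i ≤ k - 1 → (∑ e ∈ cut G (Vc i), x e) < 2) ∧
  (∀ i, 1 ≤ i → i ≤ k →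
    (∑ v ∈ level Vc k i, ∑ e ∈ cut G {v}, x e) = 2 * ((level Vc k i).card : ℝ))

/-- A Gao-tree for the chain `V_0 ⊊ … ⊊ V_k`: a spanning tree meeting each cut `δ(V_i)`
in exactly one edge. -/
def IsGaoTree (G : SimpleGraph V) (Vc : ℕ → Finset V) (k : ℕ) (T : Finset (Sym2 V)) : Prop :=
  IsSpanningTree G T ∧ ∀ i ≤ k, (T ∩ cut G (Vc i)).card = 1

/-- A Gao-tree for the subchain of `V_0 ⊊ … ⊊ V_k` given by the index set `I`. -/
def IsGaoTreeOn (G : SimpleGraph V) (Vc : ℕ → Finset V) (I : Finset ℕ)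
    (T : Finset (Sym2 V)) : Prop :=
  IsSpanningTree G T ∧ ∀ i ∈ I, (T ∩ cut G (Vc i)).card = 1

/-- `Sp_𝒞(G)`: the convex hull of characteristic vectors of Gao-trees. -/
noncomputable def gaoPolytope (G : SimpleGraph V) (Vc : ℕ → Finset V) (k : ℕ) :
    Set (Sym2 V → ℝ) :=
  convexHull ℝ {x | ∃ T : Finset (Sym2 V), IsGaoTree G Vc k T ∧ x = chi T}

/-- `F` is the edge set of a spanning tree of the induced subgraph `G(U)`. -/
def IsSpanningTreeOfInduced (G : SimpleGraph V) (U : Finset V) (F : Finset (Sym2 V)) : Prop :=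
  (F : Set (Sym2 V)) ⊆ G.edgeSet ∧ (∀ e ∈ F, ∀ v ∈ e, v ∈ U) ∧
  F.card = U.card - 1 ∧
  ∀ u ∈ U, ∀ v ∈ U, (SimpleGraph.fromEdgeSet (F : Set (Sym2 V))).Reachable u v

/-- The rank of `X` in the cycle matroid of `G`. -/
noncomputable def cycleRank (G : SimpleGraph V) (X : Finset (Sym2 V)) : ℕ :=
  (G.edgeFinset.powerset.filter (fun T => IsSpanningTree G T)).sup (fun T => (T ∩ X).card)

/-- The rank of `X` in the matroid whose bases are the Gao-trees. -/
noncomputable def gaoRank (G : SimpleGraph V) (Vc : ℕ → Finset V) (k : ℕ)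
    (X : Finset (Sym2 V)) : ℕ :=
  (G.edgeFinset.powerset.filter (fun T => IsGaoTree G Vc k T)).sup (fun T => (T ∩ X).card)

/-- `x` is a solution of the `s`–`t` path TSP subtour elimination LP. -/
def IsSubtourLPSolution (G : SimpleGraph V) (s t : V) (x : Sym2 V → ℝ) : Prop :=
  x ∈ spanningTreePolytope G ∧
  (∀ v, v ≠ s → v ≠ t → (∑ e ∈ cut G {v}, x e) = 2) ∧
  (∑ e ∈ cut G {s}, x e) = 1 ∧ (∑ e ∈ cut G {t}, x e) = 1

/-- Rank function of a matroid on a finite ground set, as a function on finsets. -/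
noncomputable def mrank {E : Type*} [Fintype E] (M : Matroid E) (X : Finset E) : ℕ :=
  (X.powerset.filter (fun I : Finset E => M.Indep (I : Set E))).sup Finset.card

/-- Convex hull of characteristic vectors of independent sets of a matroid. -/
noncomputable def indepPolytope {E : Type*} [Fintype E] (M : Matroid E) : Set (E → ℝ) :=
  convexHull ℝ {x | ∃ I : Finset E, M.Indep (I : Set E) ∧
    x = fun e => if e ∈ I then (1 : ℝ) else 0}

set_option linter.unusedSectionVars false

/-! ### Rank of an edge set over `ZMod 2` -/

/-- The incidence vector over `ZMod 2` of an unordered pair. -/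
noncomputable def edgeVec (e : Sym2 V) : V → ZMod 2 :=
  Sym2.lift ⟨fun a b => Pi.single a 1 + Pi.single b 1, fun _ _ => add_comm _ _⟩ e

/-- The span of the incidence vectors of `F`. -/
noncomputable def edgeSpan (F : Finset (Sym2 V)) : Submodule (ZMod 2) (V → ZMod 2) :=
  Submodule.span (ZMod 2) (edgeVec '' (F : Set (Sym2 V)))

/-- The rank of `F` in the cycle matroid of the complete graph. -/
noncomputable def edgeRank (F : Finset (Sym2 V)) : ℕ :=
  Module.finrank (ZMod 2) (edgeSpan F)

/-- Sum of the coordinates in `S`. -/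
noncomputable def coordSum (S : Finset V) : (V → ZMod 2) →ₗ[ZMod 2] ZMod 2 :=
  ∑ v ∈ S, LinearMap.proj v

theorem edgeVec_mk (a b : V) : edgeVec s(a, b) = Pi.single a 1 + Pi.single b 1 := rfl

theorem add_self_eq_zero_zmodTwo (y : V → ZMod 2) : y + y = 0 :=
  funext fun v => CharTwo.add_self_eq_zero (y v)

theorem edgeVec_diag (a : V) : edgeVec s(a, a) = 0 := by
  rw [edgeVec_mk, add_self_eq_zero_zmodTwo]

theorem edgeVec_add (a b c : V) : edgeVec s(a, b) + edgeVec s(b, c) = edgeVec s(a, c) := by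
  simp only [edgeVec_mk]
  rw [add_assoc, ← add_assoc (Pi.single b 1) (Pi.single b 1), add_self_eq_zero_zmodTwo, zero_add]

theorem coordSum_apply (S : Finset V) (y : V → ZMod 2) : coordSum S y = ∑ v ∈ S, y v := by
  simp [coordSum]

theorem coordSum_edgeVec (S : Finset V) (a b : V) :
    coordSum S (edgeVec s(a, b)) = (if a ∈ S then 1 else 0) + (if b ∈ S then 1 else 0) := by
  rw [coordSum_apply, edgeVec_mk]
  simp [Finset.sum_add_distrib, Finset.sum_pi_single']

theorem edgeVec_mem_edgeSpan {F : Finset (Sym2 V)} {e : Sym2 V} (he : e ∈ F) :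
    edgeVec e ∈ edgeSpan F :=
  Submodule.subset_span ⟨e, he, rfl⟩

theorem edgeSpan_le {F : Finset (Sym2 V)} {W : Submodule (ZMod 2) (V → ZMod 2)}
    (h : ∀ e ∈ F, edgeVec e ∈ W) : edgeSpan F ≤ W := by
  rw [edgeSpan, Submodule.span_le]
  rintro _ ⟨e, he, rfl⟩
  exact h e he

theorem edgeSpan_mono {F F' : Finset (Sym2 V)} (h : F ⊆ F') : edgeSpan F ≤ edgeSpan F' :=
  edgeSpan_le fun _ he => edgeVec_mem_edgeSpan (h he)

theorem edgeRank_mono {F F' : Finset (Sym2 V)} (h : F ⊆ F') : edgeRank F ≤ edgeRank F' :=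
  Submodule.finrank_mono (edgeSpan_mono h)

theorem edgeSpan_union (F F' : Finset (Sym2 V)) :
    edgeSpan (F ∪ F') = edgeSpan F ⊔ edgeSpan F' := by
  simp only [edgeSpan, Finset.coe_union, Set.image_union, Submodule.span_union]

theorem edgeRank_submodular (F F' : Finset (Sym2 V)) :
    edgeRank (F ∪ F') + edgeRank (F ∩ F') ≤ edgeRank F + edgeRank F' := by
  have h := Submodule.finrank_sup_add_finrank_inf_eq (edgeSpan F) (edgeSpan F')
  rw [← edgeSpan_union] at h
  have h2 : edgeRank (F ∩ F') ≤
      Module.finrank (ZMod 2) (edgeSpan F ⊓ edgeSpan F' : Submodule (ZMod 2) (V → ZMod 2)) :=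
    Submodule.finrank_mono
      (le_inf (edgeSpan_mono Finset.inter_subset_left) (edgeSpan_mono Finset.inter_subset_right))
  unfold edgeRank at *
  omega

theorem edgeRank_submodular_strict {F F' : Finset (Sym2 V)} {y : V → ZMod 2}
    (hF : y ∈ edgeSpan F) (hF' : y ∈ edgeSpan F') (hn : y ∉ edgeSpan (F ∩ F')) :
    edgeRank (F ∪ F') + edgeRank (F ∩ F') + 1 ≤ edgeRank F + edgeRank F' := by
  have h := Submodule.finrank_sup_add_finrank_inf_eq (edgeSpan F) (edgeSpan F')
  rw [← edgeSpan_union] at h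
  have h2 : edgeRank (F ∩ F') <
      Module.finrank (ZMod 2) (edgeSpan F ⊓ edgeSpan F' : Submodule (ZMod 2) (V → ZMod 2)) := by
    apply Submodule.finrank_lt_finrank_of_lt
    refine lt_of_le_of_ne
      (le_inf (edgeSpan_mono Finset.inter_subset_left) (edgeSpan_mono Finset.inter_subset_right)) ?_
    intro h
    exact hn (h ▸ ⟨hF, hF'⟩)
  unfold edgeRank at *
  omega

theorem edgeRank_add_one_le {F F' : Finset (Sym2 V)} (h : F ⊆ F') {y : V → ZMod 2}
    (hF' : y ∈ edgeSpan F') (hn : y ∉ edgeSpan F) : edgeRank F + 1 ≤ edgeRank F' := by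
  apply Submodule.finrank_lt_finrank_of_lt
  refine lt_of_le_of_ne (edgeSpan_mono h) ?_
  intro h
  exact hn (h ▸ hF')

theorem edgeRank_le_card (F : Finset (Sym2 V)) : edgeRank F ≤ F.card := by
  unfold edgeRank edgeSpan
  rw [← Finset.coe_image]
  exact (finrank_span_finset_le_card _).trans Finset.card_image_le

/-- `a` and `b` are connected by `F`, in the sense of the cycle space. -/
def Linked (F : Finset (Sym2 V)) (a b : V) : Prop := edgeVec s(a, b) ∈ edgeSpan F

theorem Linked.refl (F : Finset (Sym2 V)) (a : V) : Linked F a a := by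
  unfold Linked; rw [edgeVec_diag]; exact Submodule.zero_mem _

theorem Linked.symm {F : Finset (Sym2 V)} {a b : V} (h : Linked F a b) : Linked F b a := by
  unfold Linked; rw [Sym2.eq_swap]; exact h

theorem Linked.trans {F : Finset (Sym2 V)} {a b c : V} (h : Linked F a b) (h' : Linked F b c) :
    Linked F a c := by
  unfold Linked; rw [← edgeVec_add a b c]; exact Submodule.add_mem _ h h'

theorem Linked.mono {F F' : Finset (Sym2 V)} (hF : F ⊆ F') {a b : V} (h : Linked F a b) :
    Linked F' a b := edgeSpan_mono hF h

theorem Linked.of_mem {F : Finset (Sym2 V)} {a b : V} (h : s(a, b) ∈ F) : Linked F a b :=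
  edgeVec_mem_edgeSpan h

/-- No edge of `F` crosses the boundary of `S`. -/
def NoCross (F : Finset (Sym2 V)) (S : Finset V) : Prop :=
  ∀ a b, s(a, b) ∈ F → (a ∈ S ↔ b ∈ S)

theorem NoCross.coordSum_eq_zero {F : Finset (Sym2 V)} {S : Finset V} (h : NoCross F S)
    {y : V → ZMod 2} (hy : y ∈ edgeSpan F) : coordSum S y = 0 := by
  have : edgeSpan F ≤ LinearMap.ker (coordSum S) := by
    apply edgeSpan_le
    intro e
    induction e with | _ a b =>
    intro he
    rw [LinearMap.mem_ker, coordSum_edgeVec]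
    have := h a b he
    by_cases ha : a ∈ S
    · rw [if_pos ha, if_pos (this.1 ha)]; exact CharTwo.add_self_eq_zero _
    · rw [if_neg ha, if_neg (fun hb => ha (this.2 hb)), add_zero]
  exact this hy

theorem NoCross.not_linked {F : Finset (Sym2 V)} {S : Finset V} (h : NoCross F S) {a b : V}
    (ha : a ∈ S) (hb : b ∉ S) : ¬ Linked F a b := by
  intro hab
  have := h.coordSum_eq_zero hab
  rw [coordSum_edgeVec, if_pos ha, if_neg hb] at this
  simp at this

/-- Restriction of a vector to the coordinates in `S`. -/
noncomputable def coordRestrict (S : Finset V) : (V → ZMod 2) →ₗ[ZMod 2] (V → ZMod 2) where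
  toFun y := fun v => if v ∈ S then y v else 0
  map_add' y z := by ext v; by_cases hv : v ∈ S <;> simp [hv]
  map_smul' c y := by ext v; by_cases hv : v ∈ S <;> simp [hv]

theorem coordRestrict_edgeVec (S : Finset V) (a b : V) :
    coordRestrict S (edgeVec s(a, b)) =
      (if a ∈ S then Pi.single a 1 else 0) + (if b ∈ S then Pi.single b 1 else 0) := by
  ext v
  simp only [coordRestrict, LinearMap.coe_mk, AddHom.coe_mk, edgeVec_mk, Pi.add_apply]
  by_cases hv : v ∈ S <;> by_cases ha : a ∈ S <;> by_cases hb : b ∈ S <;>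
    by_cases h1 : v = a <;> by_cases h2 : v = b <;> simp_all

theorem NoCross.coordRestrict_mem {F : Finset (Sym2 V)} {S : Finset V} (h : NoCross F S)
    {y : V → ZMod 2} (hy : y ∈ edgeSpan F) : coordRestrict S y ∈ edgeSpan F := by
  have : edgeSpan F ≤ (edgeSpan F).comap (coordRestrict S) := by
    apply edgeSpan_le
    intro e
    induction e with | _ a b =>
    intro he
    rw [Submodule.mem_comap, coordRestrict_edgeVec]
    have := h a b he
    by_cases ha : a ∈ S
    · rw [if_pos ha, if_pos (this.1 ha), ← edgeVec_mk]; exact edgeVec_mem_edgeSpan he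
    · rw [if_neg ha, if_neg (fun hb => ha (this.2 hb)), add_zero]; exact Submodule.zero_mem _
  exact this hy

theorem edgeRank_add_one_le_of_noCross {F F' : Finset (Sym2 V)} (h : F ⊆ F') {S : Finset V}
    (hF : NoCross F S) {a b : V} (hab : s(a, b) ∈ F') (ha : a ∈ S) (hb : b ∉ S) :
    edgeRank F + 1 ≤ edgeRank F' :=
  edgeRank_add_one_le h (edgeVec_mem_edgeSpan hab) (hF.not_linked ha hb)

/-- If two edges of `F` that cross the boundary of `S` are not linked by `F`, then the edges
crossing it contribute at least two to the rank of `F`. -/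
theorem edgeRank_add_two_le_of_noCross {F F' : Finset (Sym2 V)} (h : F ⊆ F') {S : Finset V}
    (hF : NoCross F S) {a b a' b' : V} (hab : s(a, b) ∈ F') (ha : a ∈ S) (hb : b ∉ S)
    (hab' : s(a', b') ∈ F') (ha' : a' ∈ S) (hb' : b' ∉ S) (hn : ¬ Linked F' a a') :
    edgeRank F + 2 ≤ edgeRank F' := by
  have h1 : edgeRank F + 1 ≤ edgeRank (insert s(a, b) F) :=
    edgeRank_add_one_le_of_noCross (Finset.subset_insert _ _) hF (Finset.mem_insert_self _ _) ha hb
  have hsub : insert s(a, b) F ⊆ F' := Finset.insert_subset hab h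
  have h2 : edgeRank (insert s(a, b) F) + 1 ≤ edgeRank F' := by
    refine edgeRank_add_one_le hsub (edgeVec_mem_edgeSpan hab') ?_
    intro hmem
    rw [edgeSpan, Finset.coe_insert, Set.image_insert_eq, Submodule.mem_span_insert] at hmem
    obtain ⟨c, z, hz, hc⟩ := hmem
    change z ∈ edgeSpan F at hz
    have e1 := congrArg (coordSum S) hc
    rw [map_add, map_smul, hF.coordSum_eq_zero hz, coordSum_edgeVec, coordSum_edgeVec, if_pos ha,
      if_pos ha', if_neg hb, if_neg hb'] at e1
    have hc1 : c = 1 := by simpa using e1.symm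
    subst hc1
    have e2 := congrArg (coordRestrict S) hc
    rw [map_add, map_smul, coordRestrict_edgeVec, coordRestrict_edgeVec, if_pos ha,
      if_pos ha', if_neg hb, if_neg hb', one_smul, add_zero, add_zero] at e2
    apply hn
    apply Linked.mono h
    unfold Linked
    rw [edgeVec_mk, e2, ← add_assoc, add_self_eq_zero_zmodTwo, zero_add]
    exact hF.coordRestrict_mem hz
  omega

/-- The span of all pairs in `S` has dimension at most `|S| - 1`. -/
theorem finrank_le_of_pairs {S : Finset V} (hS : S.Nonempty)
    {W : Submodule (ZMod 2) (V → ZMod 2)}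
    (hW : W ≤ Submodule.span (ZMod 2) {y | ∃ a ∈ S, ∃ b ∈ S, y = edgeVec s(a, b)}) :
    Module.finrank (ZMod 2) W + 1 ≤ S.card := by
  obtain ⟨c, hc⟩ := hS
  have h1 : Submodule.span (ZMod 2) {y | ∃ a ∈ S, ∃ b ∈ S, y = edgeVec s(a, b)} ≤
      edgeSpan ((S.erase c).image fun a => s(a, c)) := by
    rw [Submodule.span_le]
    have hl : ∀ a ∈ S, Linked ((S.erase c).image fun a => s(a, c)) a c := by
      intro a ha
      by_cases hac : a = c
      · subst hac; exact Linked.refl _ _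
      · exact Linked.of_mem (Finset.mem_image.2 ⟨a, Finset.mem_erase.2 ⟨hac, ha⟩, rfl⟩)
    rintro _ ⟨a, ha, b, hb, rfl⟩
    exact (hl a ha).trans (hl b hb).symm
  have h2 := Submodule.finrank_mono (hW.trans h1)
  have h3 := edgeRank_le_card ((S.erase c).image fun a => s(a, c))
  have h4 : ((S.erase c).image fun a => s(a, c)).card ≤ (S.erase c).card := Finset.card_image_le
  rw [Finset.card_erase_of_mem hc] at h4
  have : 0 < S.card := Finset.card_pos.2 ⟨c, hc⟩
  unfold edgeRank at h3
  omega

theorem edgeRank_add_one_le_card {S : Finset V} (hS : S.Nonempty) {F : Finset (Sym2 V)}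
    (hF : ∀ a b, s(a, b) ∈ F → a ∈ S ∧ b ∈ S) : edgeRank F + 1 ≤ S.card := by
  apply finrank_le_of_pairs hS
  apply edgeSpan_le
  intro e
  induction e with | _ a b =>
  intro he
  exact Submodule.subset_span ⟨a, (hF a b he).1, b, (hF a b he).2, rfl⟩

theorem linked_of_card_le {S : Finset V} (hS : S.Nonempty) {F : Finset (Sym2 V)}
    (hF : ∀ a b, s(a, b) ∈ F → a ∈ S ∧ b ∈ S) (hcard : S.card ≤ edgeRank F + 1)
    {a b : V} (ha : a ∈ S) (hb : b ∈ S) : Linked F a b := by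
  by_contra hn
  have h1 : edgeRank F + 1 ≤ edgeRank (insert s(a, b) F) :=
    edgeRank_add_one_le (Finset.subset_insert _ _)
      (edgeVec_mem_edgeSpan (Finset.mem_insert_self _ _)) hn
  have h2 : edgeRank (insert s(a, b) F) + 1 ≤ S.card := by
    apply edgeRank_add_one_le_card hS
    intro u v huv
    rcases Finset.mem_insert.1 huv with h | h
    · rcases Sym2.eq_iff.1 h with ⟨rfl, rfl⟩ | ⟨rfl, rfl⟩ <;> exact ⟨‹_›, ‹_›⟩
    · exact hF u v h
  omega

theorem card_le_edgeRank_add_one [Nonempty V] {F : Finset (Sym2 V)} (h : ∀ a b, Linked F a b) :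
    Fintype.card V ≤ edgeRank F + 1 := by
  obtain ⟨c⟩ := ‹Nonempty V›
  have htop : (⊤ : Submodule (ZMod 2) (V → ZMod 2)) ≤
      edgeSpan F ⊔ Submodule.span (ZMod 2) {Pi.single c 1} := by
    intro y _
    have hy : y = ∑ v, y v • (Pi.single v 1 : V → ZMod 2) := by
      ext w
      simp [Finset.sum_apply, Pi.single_apply]
    rw [hy]
    refine Submodule.sum_mem _ fun v _ => Submodule.smul_mem _ _ ?_
    have : (Pi.single v 1 : V → ZMod 2) = edgeVec s(v, c) + Pi.single c 1 := by
      rw [edgeVec_mk, add_assoc, add_self_eq_zero_zmodTwo, add_zero]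
    rw [this]
    exact Submodule.add_mem_sup (h v c) (Submodule.mem_span_singleton_self _)
  have h1 := Submodule.finrank_mono htop
  have h2 := Submodule.finrank_add_le_finrank_add_finrank (edgeSpan F)
    (Submodule.span (ZMod 2) {(Pi.single c 1 : V → ZMod 2)})
  have h3 := finrank_span_le_card (R := ZMod 2) {(Pi.single c 1 : V → ZMod 2)}
  rw [finrank_top, Module.finrank_fintype_fun_eq_card] at h1
  simp only [Set.toFinset_singleton, Finset.card_singleton] at h3
  unfold edgeRank
  omega

/-! ### Edges relative to a level function -/

/-- The edges of `F` inside a level. -/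
noncomputable def flat (l : V → ℕ) (F : Finset (Sym2 V)) : Finset (Sym2 V) :=
  F.filter fun e => ∃ u v, e = s(u, v) ∧ l u = l v

/-- The edges of `F` between the levels `i` and `i + 1`. -/
noncomputable def rungs (l : V → ℕ) (i : ℕ) (F : Finset (Sym2 V)) : Finset (Sym2 V) :=
  F.filter fun e => ∃ u v, e = s(u, v) ∧ l u = i ∧ l v = i + 1

/-- The edges of `F` between the levels up to `i` and the levels above `i`. -/
noncomputable def across (l : V → ℕ) (i : ℕ) (F : Finset (Sym2 V)) : Finset (Sym2 V) :=
  F.filter fun e => ∃ u v, e = s(u, v) ∧ l u ≤ i ∧ i < l v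

/-- The vertices of level at most `i`. -/
noncomputable def lower (l : V → ℕ) (i : ℕ) : Finset V := Finset.univ.filter fun v => l v ≤ i

/-- The rank function of the matroid whose bases are the Gao-trees. -/
noncomputable def levelRank (l : V → ℕ) (k : ℕ) (F : Finset (Sym2 V)) : ℕ :=
  edgeRank (flat l F) + ((Finset.range (k + 1)).filter fun i => (rungs l i F).Nonempty).card

theorem exists_mk_iff (p : V → V → Prop) (a b : V) :
    (∃ u v, s(a, b) = s(u, v) ∧ p u v) ↔ p a b ∨ p b a := by
  constructor
  · rintro ⟨u, v, h, hp⟩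
    rcases Sym2.eq_iff.1 h with ⟨rfl, rfl⟩ | ⟨rfl, rfl⟩
    · exact Or.inl hp
    · exact Or.inr hp
  · rintro (h | h)
    · exact ⟨a, b, rfl, h⟩
    · exact ⟨b, a, Sym2.eq_swap, h⟩

theorem mem_flat {l : V → ℕ} {F : Finset (Sym2 V)} {a b : V} :
    s(a, b) ∈ flat l F ↔ s(a, b) ∈ F ∧ l a = l b := by
  rw [flat, Finset.mem_filter, exists_mk_iff fun u v => l u = l v, eq_comm (a := l b), or_self]

theorem mem_rungs {l : V → ℕ} {i : ℕ} {F : Finset (Sym2 V)} {a b : V} :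
    s(a, b) ∈ rungs l i F ↔
      s(a, b) ∈ F ∧ ((l a = i ∧ l b = i + 1) ∨ (l b = i ∧ l a = i + 1)) := by
  rw [rungs, Finset.mem_filter, exists_mk_iff fun u v => l u = i ∧ l v = i + 1]

theorem mem_across {l : V → ℕ} {i : ℕ} {F : Finset (Sym2 V)} {a b : V} :
    s(a, b) ∈ across l i F ↔ s(a, b) ∈ F ∧ ((l a ≤ i ∧ i < l b) ∨ (l b ≤ i ∧ i < l a)) := by
  rw [across, Finset.mem_filter, exists_mk_iff fun u v => l u ≤ i ∧ i < l v]

theorem mem_lower {l : V → ℕ} {i : ℕ} {v : V} : v ∈ lower l i ↔ l v ≤ i := by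
  simp [lower]

theorem mem_cutBetween {G : SimpleGraph V} {S S' : Finset V} {a b : V} :
    s(a, b) ∈ cutBetween G S S' ↔ G.Adj a b ∧ ((a ∈ S ∧ b ∈ S') ∨ (b ∈ S ∧ a ∈ S')) := by
  rw [cutBetween, Finset.mem_filter, exists_mk_iff fun u v => u ∈ S ∧ v ∈ S',
    SimpleGraph.mem_edgeFinset, SimpleGraph.mem_edgeSet]

theorem mem_cut {G : SimpleGraph V} {S : Finset V} {a b : V} :
    s(a, b) ∈ cut G S ↔ G.Adj a b ∧ ((a ∈ S ∧ b ∉ S) ∨ (b ∈ S ∧ a ∉ S)) := by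
  rw [cut, mem_cutBetween, Finset.mem_compl, Finset.mem_compl]

theorem mem_inducedEdges {G : SimpleGraph V} {S : Finset V} {a b : V} :
    s(a, b) ∈ inducedEdges G S ↔ G.Adj a b ∧ a ∈ S ∧ b ∈ S := by
  rw [inducedEdges, Finset.mem_filter, SimpleGraph.mem_edgeFinset, SimpleGraph.mem_edgeSet]
  simp

theorem inducedEdges_subset (G : SimpleGraph V) (S : Finset V) :
    inducedEdges G S ⊆ G.edgeFinset := Finset.filter_subset _ _

theorem levelRank_le_edgeRank (l : V → ℕ) (k : ℕ) (F : Finset (Sym2 V)) :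
    levelRank l k F ≤ edgeRank F := by
  have key : ∀ m, edgeRank (flat l F) +
      ((Finset.range m).filter fun i => (rungs l i F).Nonempty).card ≤
      edgeRank (F.filter fun e => e ∈ flat l F ∨ ∃ j < m, e ∈ rungs l j F) := by
    intro m
    induction m with
    | zero =>
      simp only [Finset.range_zero, Finset.filter_empty, Finset.card_empty, add_zero]
      apply edgeRank_mono
      intro e he
      exact Finset.mem_filter.2 ⟨Finset.filter_subset _ _ he, Or.inl he⟩
    | succ m ih =>
      have hsub : (F.filter fun e => e ∈ flat l F ∨ ∃ j < m, e ∈ rungs l j F) ⊆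
          F.filter fun e => e ∈ flat l F ∨ ∃ j < m + 1, e ∈ rungs l j F := by
        intro e he
        rw [Finset.mem_filter] at he ⊢
        refine ⟨he.1, he.2.imp id ?_⟩
        rintro ⟨j, hj, h⟩
        exact ⟨j, by omega, h⟩
      rw [Finset.range_add_one, Finset.filter_insert]
      split_ifs with hm
      · rw [Finset.card_insert_of_notMem (by simp)]
        obtain ⟨e, he⟩ := hm
        have he' := he
        rw [rungs, Finset.mem_filter] at he'
        obtain ⟨heF, a, b, rfl, ha, hb⟩ := he'
        have := edgeRank_add_one_le_of_noCross hsub (S := lower l m) (a := a) (b := b) ?_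
          (Finset.mem_filter.2 ⟨heF, Or.inr ⟨m, by omega, he⟩⟩) (by rw [mem_lower]; omega)
          (by rw [mem_lower]; omega)
        · omega
        · intro u v huv
          rw [mem_lower, mem_lower]
          obtain ⟨-, h | ⟨j, hj, h⟩⟩ := Finset.mem_filter.1 huv
          · rw [mem_flat] at h; omega
          · rw [mem_rungs] at h; omega
      · exact ih.trans (edgeRank_mono hsub)
  exact (key (k + 1)).trans (edgeRank_mono (Finset.filter_subset _ _))

theorem edgeRank_le_levelRank_of_flat {l : V → ℕ} {k : ℕ} {F : Finset (Sym2 V)}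
    (h : flat l F = F) : edgeRank F ≤ levelRank l k F := by
  rw [levelRank, h]; exact Nat.le_add_right _ _

theorem levelRank_submodular (l : V → ℕ) (k : ℕ) (F F' : Finset (Sym2 V)) :
    levelRank l k (F ∪ F') + levelRank l k (F ∩ F') ≤ levelRank l k F + levelRank l k F' := by
  have h1 := edgeRank_submodular (flat l F) (flat l F')
  have e1 : flat l (F ∪ F') = flat l F ∪ flat l F' := Finset.filter_union ..
  have e2 : flat l (F ∩ F') = flat l F ∩ flat l F' := Finset.filter_inter_distrib ..
  have h2 : ((Finset.range (k + 1)).filter fun i => (rungs l i (F ∪ F')).Nonempty).card +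
      ((Finset.range (k + 1)).filter fun i => (rungs l i (F ∩ F')).Nonempty).card ≤
      ((Finset.range (k + 1)).filter fun i => (rungs l i F).Nonempty).card +
      ((Finset.range (k + 1)).filter fun i => (rungs l i F').Nonempty).card := by
    rw [← Finset.card_union_add_card_inter ((Finset.range (k + 1)).filter fun i =>
      (rungs l i F).Nonempty)]
    apply add_le_add <;> apply Finset.card_le_card <;> intro i hi
    · rw [Finset.mem_filter] at hi
      have : rungs l i (F ∪ F') = rungs l i F ∪ rungs l i F' := Finset.filter_union ..
      rw [this, Finset.union_nonempty] at hi
      simp only [Finset.mem_union, Finset.mem_filter]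
      tauto
    · rw [Finset.mem_filter] at hi
      have : rungs l i (F ∩ F') = rungs l i F ∩ rungs l i F' := Finset.filter_inter_distrib ..
      rw [this] at hi
      simp only [Finset.mem_inter, Finset.mem_filter]
      exact ⟨⟨hi.1, hi.2.mono Finset.inter_subset_left⟩,
        ⟨hi.1, hi.2.mono Finset.inter_subset_right⟩⟩
  unfold levelRank
  rw [e1, e2]
  omega

/-- The properties of a chain-point, in terms of the level function of the chain, that force
the rank inequality `IsLevelPoint.sum_le`. -/
structure IsLevelPoint (G : SimpleGraph V) (l : V → ℕ) (k : ℕ) (x : Sym2 V → ℝ) (lam : ℝ) :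
    Prop where
  level_le : ∀ v, l v ≤ k + 1
  level_surj : ∀ i ≤ k + 1, ∃ v, l v = i
  nonneg : ∀ e, 0 ≤ x e
  sum_le_edgeRank : ∀ F : Finset (Sym2 V), ∑ e ∈ F, x e ≤ edgeRank F
  lam_pos : 0 < lam
  lam_le_one : lam ≤ 1
  cut_le : ∀ i ≤ k, ∑ e ∈ cut G (lower l i), x e ≤ 2 - lam
  le_level : ∀ i ≤ k + 1, ((Finset.univ.filter fun v => l v = i).card : ℝ) - 2 + lam ≤
    ∑ e ∈ inducedEdges G (Finset.univ.filter fun v => l v = i), x e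
  le_pair : ∀ i ≤ k, ((Finset.univ.filter fun v => l v = i ∨ l v = i + 1).card : ℝ) - 2 + lam ≤
    ∑ e ∈ inducedEdges G (Finset.univ.filter fun v => l v = i ∨ l v = i + 1), x e
  jump_le : ∀ i, ∑ e ∈ cutBetween G (Finset.univ.filter fun v => l v < i)
    (Finset.univ.filter fun v => i < l v), x e ≤ 1 - lam

namespace IsLevelPoint

variable {G : SimpleGraph V} {l : V → ℕ} {k : ℕ} {x : Sym2 V → ℝ} {lam : ℝ}

theorem linked_inducedEdges (hx : IsLevelPoint G l k x lam) {S : Finset V}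
    (hS : (S.card : ℝ) - 2 + lam ≤ ∑ e ∈ inducedEdges G S, x e) {u v : V} (hu : u ∈ S)
    (hv : v ∈ S) : Linked (inducedEdges G S) u v := by
  refine linked_of_card_le ⟨u, hu⟩ (fun a b h => (mem_inducedEdges.1 h).2) ?_ hu hv
  have h1 := hx.sum_le_edgeRank (inducedEdges G S)
  have h2 := hx.lam_pos
  have h3 : (S.card : ℝ) < edgeRank (inducedEdges G S) + 2 := by linarith
  have h4 : S.card < edgeRank (inducedEdges G S) + 2 := by exact_mod_cast h3
  omega

theorem sum_le_of_union (hx : IsLevelPoint G l k x lam) {S : Finset V}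
    (hS : (S.card : ℝ) - 2 + lam ≤ ∑ e ∈ inducedEdges G S, x e) {F : Finset (Sym2 V)} {u v : V}
    (hu : u ∈ S) (hv : v ∈ S) (hF : Linked F u v) (hn : ¬ Linked (F ∩ inducedEdges G S) u v)
    (hflat : flat l (F ∩ inducedEdges G S) = F ∩ inducedEdges G S)
    (hsum : ∑ e ∈ F ∪ inducedEdges G S, x e ≤
      lam * levelRank l k (F ∪ inducedEdges G S) +
        (1 - lam) * edgeRank (F ∪ inducedEdges G S)) :
    ∑ e ∈ F, x e ≤ lam * levelRank l k F + (1 - lam) * edgeRank F := by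
  have hSA := hx.linked_inducedEdges hS hu hv
  have h1 := edgeRank_submodular_strict hF hSA hn
  have h2 : edgeRank (inducedEdges G S) + 1 ≤ S.card :=
    edgeRank_add_one_le_card ⟨u, hu⟩ fun a b h => (mem_inducedEdges.1 h).2
  have h3 := levelRank_submodular l k F (inducedEdges G S)
  have h4 := levelRank_le_edgeRank l k (inducedEdges G S)
  have h5 := edgeRank_le_levelRank_of_flat (k := k) hflat
  have h6 := Finset.sum_union_inter (s₁ := F) (s₂ := inducedEdges G S) (f := x)
  have h7 := hx.sum_le_edgeRank (F ∩ inducedEdges G S)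
  generalize inducedEdges G S = A at *
  have a1 : levelRank l k (F ∪ A) + edgeRank (F ∩ A) + 1 ≤ levelRank l k F + S.card := by omega
  have a2 : edgeRank (F ∪ A) + edgeRank (F ∩ A) + 2 ≤ edgeRank F + S.card := by omega
  have b1 : (levelRank l k (F ∪ A) : ℝ) + edgeRank (F ∩ A) + 1 ≤ levelRank l k F + S.card := by
    exact_mod_cast a1
  have b2 : (edgeRank (F ∪ A) : ℝ) + edgeRank (F ∩ A) + 2 ≤ edgeRank F + S.card := by
    exact_mod_cast a2
  have c1 := mul_le_mul_of_nonneg_left b1 hx.lam_pos.le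
  have c2 := mul_le_mul_of_nonneg_left b2 (sub_nonneg.2 hx.lam_le_one)
  nlinarith

theorem sum_le_of_sdiff (hx : IsLevelPoint G l k x lam) {F : Finset (Sym2 V)} {i c d : ℕ}
    (hc : levelRank l k (F \ across l i F) + c ≤ levelRank l k F)
    (hd : edgeRank (F \ across l i F) + d ≤ edgeRank F)
    (hcut : ∑ e ∈ across l i F, x e ≤ lam * c + (1 - lam) * d)
    (hsum : ∑ e ∈ F \ across l i F, x e ≤
      lam * levelRank l k (F \ across l i F) + (1 - lam) * edgeRank (F \ across l i F)) :
    ∑ e ∈ F, x e ≤ lam * levelRank l k F + (1 - lam) * edgeRank F := by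
  have h1 : across l i F ⊆ F := Finset.filter_subset _ _
  rw [← Finset.sum_sdiff h1]
  have b1 : (levelRank l k (F \ across l i F) : ℝ) + c ≤ levelRank l k F := by exact_mod_cast hc
  have b2 : (edgeRank (F \ across l i F) : ℝ) + d ≤ edgeRank F := by exact_mod_cast hd
  have c1 := mul_le_mul_of_nonneg_left b1 hx.lam_pos.le
  have c2 := mul_le_mul_of_nonneg_left b2 (sub_nonneg.2 hx.lam_le_one)
  nlinarith

end IsLevelPoint

theorem levelRank_mono {l : V → ℕ} {k : ℕ} {F F' : Finset (Sym2 V)} (h : F ⊆ F') :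
    levelRank l k F ≤ levelRank l k F' := by
  refine add_le_add (edgeRank_mono (Finset.filter_subset_filter _ h)) (Finset.card_le_card ?_)
  intro i hi
  rw [Finset.mem_filter] at hi ⊢
  exact ⟨hi.1, hi.2.mono (Finset.filter_subset_filter _ h)⟩

theorem levelRank_sdiff_across_add_one_le {l : V → ℕ} {k i : ℕ} {F : Finset (Sym2 V)}
    (hi : i ≤ k) (h : (rungs l i F).Nonempty) :
    levelRank l k (F \ across l i F) + 1 ≤ levelRank l k F := by
  have h1 : edgeRank (flat l (F \ across l i F)) ≤ edgeRank (flat l F) :=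
    edgeRank_mono (Finset.filter_subset_filter _ Finset.sdiff_subset)
  have h2 : ((Finset.range (k + 1)).filter fun j => (rungs l j (F \ across l i F)).Nonempty) ⊂
      (Finset.range (k + 1)).filter fun j => (rungs l j F).Nonempty := by
    rw [Finset.ssubset_iff_of_subset]
    · refine ⟨i, Finset.mem_filter.2 ⟨Finset.mem_range.2 (by omega), h⟩, ?_⟩
      rw [Finset.mem_filter]
      rintro ⟨-, e, he⟩
      induction e with | _ a b =>
      rw [mem_rungs, Finset.mem_sdiff, mem_across] at he
      apply he.1.2
      refine ⟨he.1.1, ?_⟩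
      omega
    · intro j hj
      rw [Finset.mem_filter] at hj ⊢
      exact ⟨hj.1, hj.2.mono (Finset.filter_subset_filter _ Finset.sdiff_subset)⟩
  have h3 := Finset.card_lt_card h2
  unfold levelRank
  omega

theorem noCross_sdiff_across (l : V → ℕ) (i : ℕ) (F : Finset (Sym2 V)) :
    NoCross (F \ across l i F) (lower l i) := by
  intro a b h
  rw [Finset.mem_sdiff, mem_across] at h
  rw [mem_lower, mem_lower]
  have h1 := h.2
  simp only [h.1, true_and] at h1
  omega

theorem exists_of_across_nonempty {l : V → ℕ} {i : ℕ} {F : Finset (Sym2 V)}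
    (h : (across l i F).Nonempty) : ∃ a b, s(a, b) ∈ F ∧ l a ≤ i ∧ i < l b := by
  obtain ⟨e, he⟩ := h
  rw [across, Finset.mem_filter] at he
  obtain ⟨heF, a, b, rfl, ha, hb⟩ := he
  exact ⟨a, b, heF, ha, hb⟩

/-- If the components of `F` meet every level in a linked set, every cut in which `F` has an
edge is crossed by a single component and contains an edge between consecutive levels, then
`F` has the same rank in both matroids. -/
theorem edgeRank_le_levelRank [Nonempty V] {l : V → ℕ} {k : ℕ} {F : Finset (Sym2 V)}
    (hl : ∀ v, l v ≤ k + 1)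
    (hflat : ∀ u v, l u = l v → Linked F u v → Linked (flat l F) u v)
    (hone : ∀ i ≤ k, ∀ a b a' b', s(a, b) ∈ F → l a ≤ i → i < l b → s(a', b') ∈ F → l a' ≤ i →
      i < l b' → Linked F a a')
    (hrung : ∀ i ≤ k, (across l i F).Nonempty → (rungs l i F).Nonempty) :
    edgeRank F ≤ levelRank l k F := by
  set N := (Finset.range (k + 1)).filter fun i => (rungs l i F).Nonempty with hN
  have hch : ∀ i, ∃ e, i ∈ N → e ∈ rungs l i F := by
    intro i
    by_cases hi : i ∈ N
    · obtain ⟨e, he⟩ := (Finset.mem_filter.1 hi).2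
      exact ⟨e, fun _ => he⟩
    · exact ⟨s(Classical.arbitrary V, Classical.arbitrary V), fun h => absurd h hi⟩
  choose b hb using hch
  set F0 := flat l F ∪ N.image b with hF0
  have hsub : F0 ⊆ F := by
    apply Finset.union_subset (Finset.filter_subset _ _)
    intro e he
    obtain ⟨i, hi, rfl⟩ := Finset.mem_image.1 he
    exact Finset.filter_subset _ _ (hb i hi)
  have hlink : ∀ u v, s(u, v) ∈ F → l u ≤ l v → Linked F0 u v := by
    intro u v huv hle
    have step : ∀ t, l u + t ≤ l v → ∃ c, l c = l u + t ∧ Linked F u c ∧ Linked F0 u c := by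
      intro t
      induction t with
      | zero => intro _; exact ⟨u, rfl, Linked.refl _ _, Linked.refl _ _⟩
      | succ t ih =>
        intro ht
        obtain ⟨c, hc, h1, h2⟩ := ih (by omega)
        have hk : l u + t ≤ k := by have := hl v; omega
        have hne : (rungs l (l u + t) F).Nonempty := by
          apply hrung _ hk
          refine ⟨s(u, v), mem_across.2 ⟨huv, Or.inl ⟨by omega, by omega⟩⟩⟩
        have hmem : l u + t ∈ N := Finset.mem_filter.2 ⟨Finset.mem_range.2 (by omega), hne⟩
        have hbt := hb _ hmem
        have hb0 : b (l u + t) ∈ F0 :=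
          Finset.mem_union_right _ (Finset.mem_image_of_mem _ hmem)
        rw [rungs, Finset.mem_filter] at hbt
        obtain ⟨hbF, p, q, hpq, hp, hq⟩ := hbt
        rw [hpq] at hbF hb0
        have hup : Linked F u p :=
          hone _ hk u v p q huv (by omega) (by omega) hbF (by omega) (by omega)
        have hcp : Linked F0 c p :=
          (hflat c p (by omega) (h1.symm.trans hup)).mono Finset.subset_union_left
        exact ⟨q, by omega, hup.trans (Linked.of_mem hbF),
          (h2.trans hcp).trans (Linked.of_mem hb0)⟩
    obtain ⟨c, hc, h1, h2⟩ := step (l v - l u) (by omega)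
    exact h2.trans ((hflat c v (by omega) (h1.symm.trans (Linked.of_mem huv))).mono
      Finset.subset_union_left)
  have h1 : edgeRank F ≤ edgeRank F0 := by
    apply Submodule.finrank_mono
    apply edgeSpan_le
    intro e
    induction e with | _ u v =>
    intro huv
    rcases le_total (l u) (l v) with h | h
    · exact hlink u v huv h
    · exact (hlink v u (by rwa [Sym2.eq_swap]) h).symm
  have h2 := edgeRank_submodular (flat l F) (N.image b)
  have h3 := edgeRank_le_card (N.image b)
  have h4 : (N.image b).card ≤ N.card := Finset.card_image_le
  rw [← hF0] at h2
  rw [levelRank, ← hN]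
  omega

/-- The number of cuts between consecutive levels that `F` crosses. -/
noncomputable def crossedCuts (l : V → ℕ) (k : ℕ) (F : Finset (Sym2 V)) : ℕ :=
  ((Finset.range (k + 1)).filter fun i => (across l i F).Nonempty).card

theorem crossedCuts_sdiff_across_lt {l : V → ℕ} {k i : ℕ} {F : Finset (Sym2 V)} (hi : i ≤ k)
    (h : (across l i F).Nonempty) : crossedCuts l k (F \ across l i F) < crossedCuts l k F := by
  apply Finset.card_lt_card
  rw [Finset.ssubset_iff_of_subset]
  · refine ⟨i, Finset.mem_filter.2 ⟨Finset.mem_range.2 (by omega), h⟩, ?_⟩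
    rw [Finset.mem_filter]
    rintro ⟨-, hne⟩
    obtain ⟨a, b, hab, ha, hb⟩ := exists_of_across_nonempty hne
    rw [Finset.mem_sdiff, mem_across] at hab
    exact hab.2 ⟨hab.1, Or.inl ⟨ha, hb⟩⟩
  · intro j hj
    rw [Finset.mem_filter] at hj ⊢
    exact ⟨hj.1, hj.2.mono (Finset.filter_subset_filter _ Finset.sdiff_subset)⟩

theorem crossedCuts_union_le {l : V → ℕ} {k : ℕ} {F F' : Finset (Sym2 V)}
    (h : ∀ j, (across l j F').Nonempty → (across l j F).Nonempty) :
    crossedCuts l k (F ∪ F') ≤ crossedCuts l k F := by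
  apply Finset.card_le_card
  intro j hj
  rw [Finset.mem_filter] at hj ⊢
  have : across l j (F ∪ F') = across l j F ∪ across l j F' := Finset.filter_union ..
  rw [this, Finset.union_nonempty] at hj
  exact ⟨hj.1, hj.2.elim id (h j)⟩

namespace IsLevelPoint

variable {G : SimpleGraph V} {l : V → ℕ} {k : ℕ} {x : Sym2 V → ℝ} {lam : ℝ}

theorem sum_across_le (hx : IsLevelPoint G l k x lam) {i : ℕ} (hi : i ≤ k)
    {F : Finset (Sym2 V)} (hF : F ⊆ G.edgeFinset) : ∑ e ∈ across l i F, x e ≤ 2 - lam := by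
  refine (Finset.sum_le_sum_of_subset_of_nonneg ?_ fun e _ _ => hx.nonneg e).trans (hx.cut_le i hi)
  intro e he
  induction e with | _ a b =>
  rw [mem_across] at he
  have := SimpleGraph.mem_edgeFinset.1 (hF he.1)
  rw [mem_cut, mem_lower, mem_lower]
  exact ⟨this, by omega⟩

theorem sum_le_jump (hx : IsLevelPoint G l k x lam) (j : ℕ) {F : Finset (Sym2 V)}
    (hF : F ⊆ G.edgeFinset)
    (h : ∀ a b, s(a, b) ∈ F → (l a < j ∧ j < l b) ∨ (l b < j ∧ j < l a)) :
    ∑ e ∈ F, x e ≤ 1 - lam := by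
  refine (Finset.sum_le_sum_of_subset_of_nonneg ?_ fun e _ _ => hx.nonneg e).trans (hx.jump_le j)
  intro e he
  induction e with | _ a b =>
  rw [mem_cutBetween]
  simp only [Finset.mem_filter, Finset.mem_univ, true_and]
  exact ⟨SimpleGraph.mem_edgeFinset.1 (hF he), h a b he⟩

theorem sum_across_le_of_rungs_eq_empty (hx : IsLevelPoint G l k x lam) {i : ℕ}
    {F : Finset (Sym2 V)} (hF : F ⊆ G.edgeFinset) (hr : ¬ (rungs l i F).Nonempty) :
    ∑ e ∈ across l i F, x e ≤ 2 * (1 - lam) := by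
  set J := (across l i F).filter fun e => e ∈ cutBetween G (Finset.univ.filter fun v => l v < i)
    (Finset.univ.filter fun v => i < l v) with hJ
  have hsub : J ⊆ across l i F := Finset.filter_subset _ _
  have hE : across l i F ⊆ G.edgeFinset := (Finset.filter_subset _ _).trans hF
  rw [← Finset.sum_sdiff hsub]
  have h1 : ∑ e ∈ J, x e ≤ 1 - lam := by
    refine hx.sum_le_jump i (hsub.trans hE) ?_
    intro a b hab
    have := (Finset.mem_filter.1 hab).2
    rw [mem_cutBetween] at this
    simpa using this.2
  have h2 : ∑ e ∈ across l i F \ J, x e ≤ 1 - lam := by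
    refine hx.sum_le_jump (i + 1) (Finset.sdiff_subset.trans hE) ?_
    intro a b hab
    obtain ⟨hab, hn⟩ := Finset.mem_sdiff.1 hab
    have hadj := SimpleGraph.mem_edgeFinset.1 (hE hab)
    have hab' := mem_across.1 hab
    have h3 : ¬ ((l a < i ∧ i < l b) ∨ (l b < i ∧ i < l a)) := by
      intro h
      apply hn
      rw [hJ, Finset.mem_filter, mem_cutBetween]
      simp only [Finset.mem_filter, Finset.mem_univ, true_and]
      exact ⟨hab, hadj, h⟩
    have h4 : ¬ ((l a = i ∧ l b = i + 1) ∨ (l b = i ∧ l a = i + 1)) := fun h =>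
      hr ⟨s(a, b), mem_rungs.2 ⟨hab'.1, h⟩⟩
    omega
  linarith

theorem sum_le_step [Nonempty V] (hx : IsLevelPoint G l k x lam) {F : Finset (Sym2 V)}
    (hF : F ⊆ G.edgeFinset)
    (ihU : ∀ F' ⊆ G.edgeFinset, F ⊂ F' → crossedCuts l k F' ≤ crossedCuts l k F →
      ∑ e ∈ F', x e ≤ lam * levelRank l k F' + (1 - lam) * edgeRank F')
    (ihD : ∀ F' ⊆ G.edgeFinset, crossedCuts l k F' < crossedCuts l k F →
      ∑ e ∈ F', x e ≤ lam * levelRank l k F' + (1 - lam) * edgeRank F') :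
    ∑ e ∈ F, x e ≤ lam * levelRank l k F + (1 - lam) * edgeRank F := by
  have hunion : ∀ {S : Finset V} {u v : V},
      (S.card : ℝ) - 2 + lam ≤ ∑ e ∈ inducedEdges G S, x e → u ∈ S → v ∈ S → Linked F u v →
      ¬ Linked (F ∩ inducedEdges G S) u v →
      flat l (F ∩ inducedEdges G S) = F ∩ inducedEdges G S →
      (∀ j, (across l j (inducedEdges G S)).Nonempty → (across l j F).Nonempty) →
      ∑ e ∈ F, x e ≤ lam * levelRank l k F + (1 - lam) * edgeRank F := by
    intro S u v hS hu hv huv hn hfl hcr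
    refine hx.sum_le_of_union hS hu hv huv hn hfl (ihU _ ?_ ?_ (crossedCuts_union_le hcr))
    · exact Finset.union_subset hF (inducedEdges_subset _ _)
    · refine Finset.ssubset_iff_subset_ne.2 ⟨Finset.subset_union_left, fun h => hn ?_⟩
      have hsub : inducedEdges G S ⊆ F := Finset.union_eq_left.1 h.symm
      rw [Finset.inter_eq_right.2 hsub]
      exact hx.linked_inducedEdges hS hu hv
  have hdelete : ∀ {i c d : ℕ}, i ≤ k → (across l i F).Nonempty →
      levelRank l k (F \ across l i F) + c ≤ levelRank l k F →
      edgeRank (F \ across l i F) + d ≤ edgeRank F →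
      ∑ e ∈ across l i F, x e ≤ lam * c + (1 - lam) * d →
      ∑ e ∈ F, x e ≤ lam * levelRank l k F + (1 - lam) * edgeRank F := by
    intro i c d hi hne hc hd hcut
    exact hx.sum_le_of_sdiff hc hd hcut
      (ihD _ (Finset.sdiff_subset.trans hF) (crossedCuts_sdiff_across_lt hi hne))
  by_cases hflat : ∀ u v, l u = l v → Linked F u v → Linked (flat l F) u v
  swap
  · push Not at hflat
    obtain ⟨u, v, huv, hL, hn⟩ := hflat
    have hmem : ∀ a b, s(a, b) ∈ F ∩ inducedEdges G (Finset.univ.filter fun w => l w = l u) →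
        s(a, b) ∈ flat l F := by
      intro a b hab
      rw [Finset.mem_inter, mem_inducedEdges] at hab
      simp only [Finset.mem_filter, Finset.mem_univ, true_and] at hab
      exact mem_flat.2 ⟨hab.1, by omega⟩
    refine hunion (hx.le_level (l u) (hx.level_le u)) (u := u) (v := v) (by simp)
      (by simp [huv]) hL ?_ ?_ ?_
    · intro h
      refine hn (h.mono ?_)
      intro e he
      induction e with | _ a b => exact hmem a b he
    · apply Finset.filter_true_of_mem
      intro e he
      induction e with | _ a b => exact ⟨a, b, rfl, (mem_flat.1 (hmem a b he)).2⟩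
    · intro j hj
      obtain ⟨a, b, hab, ha, hb⟩ := exists_of_across_nonempty hj
      rw [mem_inducedEdges] at hab
      simp only [Finset.mem_filter, Finset.mem_univ, true_and] at hab
      omega
  by_cases hpair : ∀ u v, l v = l u + 1 → Linked F u v → (rungs l (l u) F).Nonempty
  swap
  · push Not at hpair
    obtain ⟨u, v, huv, hL, hr⟩ := hpair
    have hk : l u ≤ k := by have := hx.level_le v; omega
    have hmem : ∀ a b, s(a, b) ∈ F ∩ inducedEdges G
        (Finset.univ.filter fun w => l w = l u ∨ l w = l u + 1) → l a = l b := by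
      intro a b hab
      rw [Finset.mem_inter, mem_inducedEdges] at hab
      simp only [Finset.mem_filter, Finset.mem_univ, true_and] at hab
      have : s(a, b) ∉ rungs l (l u) F := by rw [hr]; exact Finset.notMem_empty _
      rw [mem_rungs] at this
      simp only [hab.1, true_and] at this
      omega
    refine hunion (hx.le_pair (l u) hk) (u := u) (v := v) (by simp) (by simp [huv]) hL ?_ ?_ ?_
    · apply NoCross.not_linked (S := lower l (l u))
      · intro a b hab
        rw [mem_lower, mem_lower, hmem a b hab]
      · rw [mem_lower]
      · rw [mem_lower]; omega
    · apply Finset.filter_true_of_mem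
      intro e he
      induction e with | _ a b => exact ⟨a, b, rfl, hmem a b he⟩
    · intro j hj
      obtain ⟨a, b, hab, ha, hb⟩ := exists_of_across_nonempty hj
      rw [mem_inducedEdges] at hab
      simp only [Finset.mem_filter, Finset.mem_univ, true_and] at hab
      have hj : j = l u := by omega
      subst hj
      by_contra hne
      refine NoCross.not_linked (F := F) (S := lower l (l u)) ?_ (by rw [mem_lower])
        (by rw [mem_lower]; omega) hL
      have := noCross_sdiff_across l (l u) F
      rwa [Finset.not_nonempty_iff_eq_empty.1 hne, Finset.sdiff_empty] at this
  by_cases hone : ∀ i ≤ k, ∀ a b a' b', s(a, b) ∈ F → l a ≤ i → i < l b → s(a', b') ∈ F →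
      l a' ≤ i → i < l b' → Linked F a a'
  swap
  · push Not at hone
    obtain ⟨i, hi, a, b, a', b', hab, ha, hb, hab', ha', hb', hn⟩ := hone
    have hne : (across l i F).Nonempty := ⟨s(a, b), mem_across.2 ⟨hab, Or.inl ⟨ha, hb⟩⟩⟩
    have hd : edgeRank (F \ across l i F) + 2 ≤ edgeRank F :=
      edgeRank_add_two_le_of_noCross Finset.sdiff_subset (noCross_sdiff_across l i F) hab
        (mem_lower.2 ha) (by rw [mem_lower]; omega) hab' (mem_lower.2 ha')
        (by rw [mem_lower]; omega) hn
    by_cases hr : (rungs l i F).Nonempty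
    · refine hdelete hi hne (levelRank_sdiff_across_add_one_le hi hr) hd ?_
      have := hx.sum_across_le hi hF
      push_cast
      linarith
    · refine hdelete (c := 0) hi hne (levelRank_mono Finset.sdiff_subset) hd ?_
      have := hx.sum_across_le_of_rungs_eq_empty hF hr
      push_cast
      linarith
  by_cases hrung : ∀ i ≤ k, (across l i F).Nonempty → (rungs l i F).Nonempty
  swap
  · push Not at hrung
    obtain ⟨i, hi, hne, hr⟩ := hrung
    rw [← Finset.not_nonempty_iff_eq_empty] at hr
    obtain ⟨p, q, hpq, hp, hq⟩ := exists_of_across_nonempty hne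
    have hd : edgeRank (F \ across l i F) + 1 ≤ edgeRank F :=
      edgeRank_add_one_le_of_noCross Finset.sdiff_subset (noCross_sdiff_across l i F) hpq
        (mem_lower.2 hp) (by rw [mem_lower]; omega)
    refine hdelete (c := 0) hi hne (levelRank_mono Finset.sdiff_subset) hd ?_
    have hE : across l i F ⊆ G.edgeFinset := (Finset.filter_subset _ _).trans hF
    have hsep : ∀ a b a' b', s(a, b) ∈ F → l a ≤ i → i < l b → s(a', b') ∈ F →
        l a' ≤ i → i < l b' → l a = i → l b' ≠ i + 1 := by
      intro a b a' b' hab ha hb hab' ha' hb' h1 h2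
      have := hpair a b' (by omega)
        ((hone i hi a b a' b' hab ha hb hab' ha' hb').trans (Linked.of_mem hab'))
      rw [h1] at this
      exact hr this
    suffices ∑ e ∈ across l i F, x e ≤ 1 - lam by push_cast; linarith
    by_cases hlow : ∃ a b, s(a, b) ∈ F ∧ l a = i ∧ i < l b
    · obtain ⟨a, b, hab, ha, hb⟩ := hlow
      refine hx.sum_le_jump (i + 1) hE ?_
      intro a' b' hab'
      rw [mem_across] at hab'
      obtain ⟨hF', ⟨h1, h2⟩ | ⟨h1, h2⟩⟩ := hab'
      · have := hsep a b a' b' hab (by omega) hb hF' h1 h2 ha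
        omega
      · have := hsep a b b' a' hab (by omega) hb (by rwa [Sym2.eq_swap]) h1 h2 ha
        omega
    · refine hx.sum_le_jump i hE ?_
      push Not at hlow
      intro a' b' hab'
      rw [mem_across] at hab'
      obtain ⟨hF', ⟨h1, h2⟩ | ⟨h1, h2⟩⟩ := hab'
      · have := hlow a' b' hF'
        omega
      · have := hlow b' a' (by rwa [Sym2.eq_swap])
        omega
  have h1 := edgeRank_le_levelRank hx.level_le hflat hone hrung
  have h2 : (edgeRank F : ℝ) ≤ levelRank l k F := by exact_mod_cast h1
  have h3 := mul_le_mul_of_nonneg_left h2 hx.lam_pos.le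
  have h4 := hx.sum_le_edgeRank F
  linarith

/-- The rank inequality that characterizes membership in the polytope
`lam * Sp_𝒞(G) + (1 - lam) * Sp(G)`. -/
theorem sum_le [Nonempty V] (hx : IsLevelPoint G l k x lam) {F : Finset (Sym2 V)}
    (hF : F ⊆ G.edgeFinset) :
    ∑ e ∈ F, x e ≤ lam * levelRank l k F + (1 - lam) * edgeRank F := by
  generalize hm : crossedCuts l k F * (G.edgeFinset.card + 1) + (G.edgeFinset \ F).card = m
  induction m using Nat.strong_induction_on generalizing F with
  | _ m ih =>
    refine hx.sum_le_step hF ?_ ?_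
    · intro F' hF' hlt hc
      refine ih _ ?_ hF' rfl
      rw [← hm]
      have h1 : (G.edgeFinset \ F').card < (G.edgeFinset \ F).card := by
        apply Finset.card_lt_card
        rw [Finset.ssubset_iff_of_subset (Finset.sdiff_subset_sdiff subset_rfl hlt.1)]
        obtain ⟨e, he, hn⟩ := Finset.exists_of_ssubset hlt
        exact ⟨e, Finset.mem_sdiff.2 ⟨hF' he, hn⟩, fun h => (Finset.mem_sdiff.1 h).2 he⟩
      have := Nat.mul_le_mul_right (G.edgeFinset.card + 1) hc
      omega
    · intro F' hF' hc
      refine ih _ ?_ hF' rfl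
      rw [← hm]
      have h1 : (G.edgeFinset \ F').card ≤ G.edgeFinset.card :=
        Finset.card_le_card Finset.sdiff_subset
      have := Nat.mul_le_mul_right (G.edgeFinset.card + 1) hc
      rw [Nat.succ_mul] at this
      omega

end IsLevelPoint

/-! ### Spanning trees and the rank -/

theorem linked_of_reachable {F : Finset (Sym2 V)} {a b : V}
    (h : (SimpleGraph.fromEdgeSet (F : Set (Sym2 V))).Reachable a b) : Linked F a b := by
  obtain ⟨p⟩ := h
  induction p with
  | nil => exact Linked.refl _ _
  | cons hadj _ ih =>
    rw [SimpleGraph.fromEdgeSet_adj] at hadj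
    exact (Linked.of_mem (Finset.mem_coe.1 hadj.1)).trans ih

theorem reachable_of_linked {F : Finset (Sym2 V)} {a b : V} (h : Linked F a b) :
    (SimpleGraph.fromEdgeSet (F : Set (Sym2 V))).Reachable a b := by
  by_contra hn
  refine NoCross.not_linked (F := F) (S := Finset.univ.filter fun v =>
    (SimpleGraph.fromEdgeSet (F : Set (Sym2 V))).Reachable a v) ?_ (by simp) (by simpa using hn) h
  intro u v huv
  simp only [Finset.mem_filter, Finset.mem_univ, true_and]
  by_cases huv' : u = v
  · rw [huv']
  have hadj : (SimpleGraph.fromEdgeSet (F : Set (Sym2 V))).Adj u v := by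
    rw [SimpleGraph.fromEdgeSet_adj]; exact ⟨Finset.mem_coe.2 huv, huv'⟩
  exact ⟨fun h => h.trans hadj.reachable, fun h => h.trans hadj.symm.reachable⟩

theorem card_edgeSet_fromEdgeSet {G : SimpleGraph V} {T : Finset (Sym2 V)}
    (hT : (T : Set (Sym2 V)) ⊆ G.edgeSet) :
    Nat.card (SimpleGraph.fromEdgeSet (T : Set (Sym2 V))).edgeSet = T.card := by
  rw [SimpleGraph.edgeSet_fromEdgeSet]
  have : (T : Set (Sym2 V)) \ Sym2.diagSet = T := by
    refine sdiff_eq_left.2 (Set.disjoint_left.2 fun e he hd => ?_)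
    exact G.not_isDiag_of_mem_edgeSet (hT he) (by simpa using hd)
  rw [this, Nat.card_coe_set_eq, Set.ncard_coe_finset]

theorem IsSpanningTree.card_add_one {G : SimpleGraph V} {T : Finset (Sym2 V)}
    (hT : IsSpanningTree G T) : T.card + 1 = Fintype.card V := by
  have := (SimpleGraph.isTree_iff_connected_and_card.1 hT.2).2
  rwa [card_edgeSet_fromEdgeSet hT.1, Nat.card_eq_fintype_card] at this

theorem IsSpanningTree.card_inter_le {G : SimpleGraph V} {T : Finset (Sym2 V)}
    (hT : IsSpanningTree G T) (F : Finset (Sym2 V)) : (T ∩ F).card ≤ edgeRank F := by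
  have hc := hT.2.connected
  have := hc.nonempty
  have h1 := card_le_edgeRank_add_one fun a b => linked_of_reachable (hc.preconnected a b)
  have h2 := hT.card_add_one
  have h3 := edgeRank_submodular (T ∩ F) (T \ F)
  have h4 : T ∩ F ∪ T \ F = T := sup_inf_sdiff T F
  rw [h4] at h3
  have h5 := edgeRank_le_card (T \ F)
  have h6 := Finset.card_inter_add_card_sdiff T F
  have h7 : edgeRank (T ∩ F) ≤ edgeRank F := edgeRank_mono Finset.inter_subset_right
  omega

theorem isSpanningTree_of_linked [Nonempty V] {G : SimpleGraph V} {T : Finset (Sym2 V)}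
    (hT : T ⊆ G.edgeFinset) (hl : ∀ a b, Linked T a b) (hc : T.card ≤ edgeRank T) :
    IsSpanningTree G T := by
  have hT' : (T : Set (Sym2 V)) ⊆ G.edgeSet := fun e he => SimpleGraph.mem_edgeFinset.1 (hT he)
  refine ⟨hT', SimpleGraph.isTree_iff_connected_and_card.2 ⟨⟨fun a b =>
    reachable_of_linked (hl a b)⟩, ?_⟩⟩
  rw [card_edgeSet_fromEdgeSet hT', Nat.card_eq_fintype_card]
  have h1 := card_le_edgeRank_add_one hl
  have h2 := edgeRank_add_one_le_card (S := Finset.univ) Finset.univ_nonempty (F := T) (by simp)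
  have h3 := edgeRank_le_card T
  rw [Finset.card_univ] at h2
  omega

/-! ### The greedy algorithm -/

/-- `F` is closed upwards in `A` with respect to the weight `w`. -/
def IsUpper (w : Sym2 V → ℝ) (A F : Finset (Sym2 V)) : Prop :=
  F ⊆ A ∧ ∀ e ∈ F, ∀ e' ∈ A, w e ≤ w e' → e' ∈ F

theorem exists_spanning_extension {T A : Finset (Sym2 V)} (hT : T ⊆ A)
    (hc : T.card ≤ edgeRank T) :
    ∃ T', T ⊆ T' ∧ T' ⊆ A ∧ T'.card ≤ edgeRank T' ∧ edgeSpan A ≤ edgeSpan T' := by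
  obtain ⟨T', hT', hmax⟩ := Finset.exists_max_image
    (A.powerset.filter fun T' => T ⊆ T' ∧ T'.card ≤ edgeRank T') Finset.card
    ⟨T, Finset.mem_filter.2 ⟨Finset.mem_powerset.2 hT, subset_rfl, hc⟩⟩
  obtain ⟨hA, hTT', hc'⟩ := Finset.mem_filter.1 hT'
  rw [Finset.mem_powerset] at hA
  refine ⟨T', hTT', hA, hc', edgeSpan_le fun e he => ?_⟩
  by_contra hn
  have he' : e ∉ T' := fun h => hn (edgeVec_mem_edgeSpan h)
  have h1 : edgeRank T' + 1 ≤ edgeRank (insert e T') :=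
    edgeRank_add_one_le (Finset.subset_insert _ _)
      (edgeVec_mem_edgeSpan (Finset.mem_insert_self _ _)) hn
  have h2 := Finset.card_insert_of_notMem he'
  have h3 := hmax (insert e T') (Finset.mem_filter.2 ⟨Finset.mem_powerset.2
    (Finset.insert_subset he hA), hTT'.trans (Finset.subset_insert _ _), by omega⟩)
  omega

theorem exists_greedy_basis (w : Sym2 V → ℝ) (A : Finset (Sym2 V)) :
    ∃ T ⊆ A, T.card ≤ edgeRank T ∧ edgeSpan A ≤ edgeSpan T ∧
      ∀ F, IsUpper w A F → edgeRank F ≤ (T ∩ F).card := by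
  induction A using Finset.strongInduction with
  | H A ih =>
    rcases A.eq_empty_or_nonempty with rfl | hA
    · refine ⟨∅, subset_rfl, by simp, le_rfl, fun F hF => ?_⟩
      rw [Finset.subset_empty.1 hF.1]
      exact edgeRank_le_card _
    obtain ⟨e₀, he₀, hmin⟩ := Finset.exists_min_image A w hA
    have hss : A.filter (fun e => w e₀ < w e) ⊂ A :=
      Finset.filter_ssubset.2 ⟨e₀, he₀, lt_irrefl _⟩
    obtain ⟨T₀, hT₀, hc₀, -, hup₀⟩ := ih _ hss
    obtain ⟨T, hTT, hTA, hc, hs⟩ := exists_spanning_extension (hT₀.trans hss.1) hc₀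
    refine ⟨T, hTA, hc, hs, fun F hF => ?_⟩
    by_cases h : ∃ e ∈ F, w e ≤ w e₀
    · obtain ⟨e, he, hle⟩ := h
      have hFA : F = A :=
        subset_antisymm hF.1 fun e' he' => hF.2 e he e' he' (hle.trans (hmin e' he'))
      subst hFA
      rw [Finset.inter_eq_left.2 hTA]
      exact (Submodule.finrank_mono hs).trans (edgeRank_le_card T)
    · push Not at h
      have hF' : IsUpper w (A.filter fun e => w e₀ < w e) F :=
        ⟨fun e he => Finset.mem_filter.2 ⟨hF.1 he, h e he⟩,
          fun e he e' he' => hF.2 e he e' (hss.1 he')⟩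
      exact (hup₀ F hF').trans
        (Finset.card_le_card (Finset.inter_subset_inter_right hTT))

theorem sum_mul_nonneg_of_upper {w z : Sym2 V → ℝ} {A : Finset (Sym2 V)}
    (hw : ∀ e ∈ A, 0 ≤ w e) (h : ∀ F, IsUpper w A F → 0 ≤ ∑ e ∈ F, z e) :
    0 ≤ ∑ e ∈ A, w e * z e := by
  induction A using Finset.strongInduction generalizing w with
  | H A ih =>
    rcases A.eq_empty_or_nonempty with rfl | hA
    · simp
    obtain ⟨e₀, he₀, hmin⟩ := Finset.exists_min_image A w hA
    have hss : A.filter (fun e => w e₀ < w e) ⊂ A :=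
      Finset.filter_ssubset.2 ⟨e₀, he₀, lt_irrefl _⟩
    have h1 := ih _ hss (w := fun e => w e - w e₀)
      (fun e he => sub_nonneg.2 (Finset.mem_filter.1 he).2.le) (by
        intro F hF
        refine h F ⟨hF.1.trans hss.1, fun e he e' he' hle => ?_⟩
        have h2 := (Finset.mem_filter.1 (hF.1 he)).2
        exact hF.2 e he e' (Finset.mem_filter.2 ⟨he', h2.trans_le hle⟩)
          (sub_le_sub_right hle _))
    have h2 : ∑ e ∈ A.filter (fun e => w e₀ < w e), (w e - w e₀) * z e =
        ∑ e ∈ A, (w e - w e₀) * z e := by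
      refine Finset.sum_subset hss.1 fun e he hn => ?_
      have : w e = w e₀ :=
        le_antisymm (not_lt.1 fun hlt => hn (Finset.mem_filter.2 ⟨he, hlt⟩)) (hmin e he)
      rw [this, sub_self, zero_mul]
    have h3 : ∑ e ∈ A, w e * z e = w e₀ * ∑ e ∈ A, z e + ∑ e ∈ A, (w e - w e₀) * z e := by
      rw [Finset.mul_sum, ← Finset.sum_add_distrib]
      exact Finset.sum_congr rfl fun e _ => by ring
    rw [h3, ← h2]
    exact add_nonneg (mul_nonneg (hw e₀ he₀) (h A ⟨subset_rfl, fun _ _ _ he' _ => he'⟩)) h1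

theorem sum_mul_nonneg_of_upper_of_sum_eq_zero {w z : Sym2 V → ℝ} {A : Finset (Sym2 V)}
    (h : ∀ F, IsUpper w A F → 0 ≤ ∑ e ∈ F, z e) (h0 : ∑ e ∈ A, z e = 0) :
    0 ≤ ∑ e ∈ A, w e * z e := by
  rcases A.eq_empty_or_nonempty with rfl | hA
  · simp
  obtain ⟨e₀, he₀, hmin⟩ := Finset.exists_min_image A w hA
  have h1 := sum_mul_nonneg_of_upper (w := fun e => w e - w e₀) (z := z) (A := A)
    (fun e he => sub_nonneg.2 (hmin e he))
    (fun F hF => h F ⟨hF.1, fun e he e' he' hle => hF.2 e he e' he' (sub_le_sub_right hle _)⟩)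
  simp only [sub_mul, Finset.sum_sub_distrib, ← Finset.mul_sum, h0, mul_zero, sub_zero] at h1
  exact h1

namespace IsLevelPoint

variable {G : SimpleGraph V} {l : V → ℕ} {k : ℕ} {x : Sym2 V → ℝ} {lam : ℝ}

theorem rungs_nonempty (hx : IsLevelPoint G l k x lam) {i : ℕ} (hi : i ≤ k) :
    (rungs l i G.edgeFinset).Nonempty := by
  by_contra hne
  obtain ⟨u, hu⟩ := hx.level_surj i (by omega)
  obtain ⟨v, hv⟩ := hx.level_surj (i + 1) (by omega)
  refine NoCross.not_linked (S := lower l i) ?_ (by rw [mem_lower]; omega)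
    (by rw [mem_lower]; omega)
    (hx.linked_inducedEdges (hx.le_pair i hi) (u := u) (v := v) (by simp [hu]) (by simp [hv]))
  intro a b hab
  have h1 : s(a, b) ∉ rungs l i G.edgeFinset := fun h => hne ⟨_, h⟩
  rw [mem_rungs] at h1
  simp only [inducedEdges_subset _ _ hab, true_and] at h1
  rw [mem_inducedEdges] at hab
  simp only [Finset.mem_filter, Finset.mem_univ, true_and] at hab
  rw [mem_lower, mem_lower]
  omega

/-- A maximum weight Gao-tree, found by the greedy algorithm. -/
theorem exists_greedy_gaoTree [Nonempty V] (hx : IsLevelPoint G l k x lam) (w : Sym2 V → ℝ) :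
    ∃ T, IsSpanningTree G T ∧ (∀ i ≤ k, (T ∩ cut G (lower l i)).card = 1) ∧
      ∀ F, IsUpper w G.edgeFinset F → levelRank l k F ≤ (T ∩ F).card := by
  obtain ⟨T₀, hT₀, hc₀, hs₀, hup₀⟩ := exists_greedy_basis w (flat l G.edgeFinset)
  have hch : ∀ i, ∃ e, i ≤ k → e ∈ rungs l i G.edgeFinset ∧
      ∀ e' ∈ rungs l i G.edgeFinset, w e' ≤ w e := by
    intro i
    by_cases hi : i ≤ k
    · obtain ⟨e, he, hmax⟩ := Finset.exists_max_image _ w (hx.rungs_nonempty hi)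
      exact ⟨e, fun _ => ⟨he, hmax⟩⟩
    · exact ⟨s(Classical.arbitrary V, Classical.arbitrary V), fun h => absurd h hi⟩
  choose b hb using hch
  have hflat : flat l G.edgeFinset ⊆ G.edgeFinset := Finset.filter_subset _ _
  have hbdata : ∀ i ≤ k, ∃ p q, b i = s(p, q) ∧ G.Adj p q ∧ l p = i ∧ l q = i + 1 := by
    intro i hi
    have h := (hb i hi).1
    rw [rungs, Finset.mem_filter] at h
    obtain ⟨hE, p, q, hpq, hp, hq⟩ := h
    rw [hpq, SimpleGraph.mem_edgeFinset] at hE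
    exact ⟨p, q, hpq, hE, hp, hq⟩
  have hbinj : ∀ i ≤ k, ∀ j, b i ∈ rungs l j G.edgeFinset → i = j := by
    intro i hi j hj
    obtain ⟨p, q, hpq, -, hp, hq⟩ := hbdata i hi
    rw [hpq, mem_rungs] at hj
    omega
  have hbflat : ∀ i ≤ k, b i ∉ flat l G.edgeFinset := by
    intro i hi h
    obtain ⟨p, q, hpq, -, hp, hq⟩ := hbdata i hi
    rw [hpq, mem_flat] at h
    omega
  set T := T₀ ∪ (Finset.range (k + 1)).image b with hT
  have hmemb : ∀ i ≤ k, b i ∈ T := fun i hi =>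
    Finset.mem_union_right _ (Finset.mem_image_of_mem _ (Finset.mem_range.2 (by omega)))
  have hTE : T ⊆ G.edgeFinset := by
    refine Finset.union_subset (hT₀.trans hflat) fun e he => ?_
    obtain ⟨i, hi, rfl⟩ := Finset.mem_image.1 he
    have hi' := Finset.mem_range.1 hi
    exact Finset.filter_subset _ _ (hb i (by omega)).1
  have hlevel : ∀ u v, l u = l v → Linked T u v := by
    intro u v huv
    have h1 := hx.linked_inducedEdges (hx.le_level (l u) (hx.level_le u)) (u := u) (v := v)
      (by simp) (by simp [huv])
    have h2 : inducedEdges G (Finset.univ.filter fun w => l w = l u) ⊆ flat l G.edgeFinset := by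
      intro e he
      induction e with | _ a c =>
      have h3 := mem_inducedEdges.1 he
      simp only [Finset.mem_filter, Finset.mem_univ, true_and] at h3
      exact mem_flat.2 ⟨inducedEdges_subset _ _ he, by omega⟩
    exact edgeSpan_mono Finset.subset_union_left (hs₀ (h1.mono h2))
  obtain ⟨r, hr⟩ := hx.level_surj 0 (by omega)
  have hroot : ∀ i ≤ k + 1, ∀ v, l v = i → Linked T r v := by
    intro i
    induction i with
    | zero => intro _ v hv; exact hlevel r v (by omega)
    | succ i ih =>
      intro hi v hv
      obtain ⟨p, q, hpq, -, hp, hq⟩ := hbdata i (by omega)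
      have hm := hmemb i (by omega)
      rw [hpq] at hm
      exact ((ih (by omega) p hp).trans (Linked.of_mem hm)).trans (hlevel q v (by omega))
  have hlink : ∀ u v, Linked T u v := fun u v =>
    (hroot _ (hx.level_le u) u rfl).symm.trans (hroot _ (hx.level_le v) v rfl)
  have hcard : T.card ≤ edgeRank T := by
    refine le_trans ?_ (levelRank_le_edgeRank l k T)
    have h1 : edgeRank T₀ ≤ edgeRank (flat l T) := by
      apply edgeRank_mono
      intro e he
      have h2 := hT₀ he
      exact Finset.mem_filter.2 ⟨Finset.mem_union_left _ he, (Finset.mem_filter.1 h2).2⟩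
    have h2 : (Finset.range (k + 1)).filter (fun i => (rungs l i T).Nonempty) =
        Finset.range (k + 1) := by
      refine Finset.filter_true_of_mem fun i hi => ⟨b i, ?_⟩
      have hi' := Finset.mem_range.1 hi
      exact Finset.mem_filter.2 ⟨hmemb i (by omega),
        (Finset.mem_filter.1 (hb i (by omega)).1).2⟩
    have h3 : T.card ≤ T₀.card + ((Finset.range (k + 1)).image b).card := Finset.card_union_le _ _
    have h4 : ((Finset.range (k + 1)).image b).card ≤ (Finset.range (k + 1)).card :=
      Finset.card_image_le
    rw [levelRank, h2]
    omega
  refine ⟨T, isSpanningTree_of_linked hTE hlink hcard, ?_, ?_⟩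
  · intro i hi
    rw [Finset.card_eq_one]
    refine ⟨b i, subset_antisymm ?_ ?_⟩
    · intro e he
      rw [Finset.mem_inter] at he
      rw [Finset.mem_singleton]
      obtain ⟨heT, hecut⟩ := he
      rcases Finset.mem_union.1 heT with h | h
      · exfalso
        have h1 := hT₀ h
        induction e with | _ u v =>
        rw [mem_flat] at h1
        rw [mem_cut, mem_lower, mem_lower] at hecut
        omega
      · obtain ⟨j, hj, rfl⟩ := Finset.mem_image.1 h
        have hj' := Finset.mem_range.1 hj
        obtain ⟨p, q, hpq, -, hp, hq⟩ := hbdata j (by omega)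
        rw [hpq, mem_cut, mem_lower, mem_lower] at hecut
        have : j = i := by omega
        rw [this]
    · intro e he
      rw [Finset.mem_singleton] at he
      subst he
      refine Finset.mem_inter.2 ⟨hmemb i hi, ?_⟩
      obtain ⟨p, q, hpq, hadj, hp, hq⟩ := hbdata i hi
      rw [hpq, mem_cut, mem_lower, mem_lower]
      exact ⟨hadj, by omega⟩
  · intro F hF
    have h1 : edgeRank (flat l F) ≤ (T₀ ∩ flat l F).card := by
      refine hup₀ _ ⟨Finset.filter_subset_filter _ hF.1, fun e he e' he' hle => ?_⟩
      exact Finset.mem_filter.2 ⟨hF.2 e (Finset.filter_subset _ _ he) e' (hflat he') hle,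
        (Finset.mem_filter.1 he').2⟩
    set N := (Finset.range (k + 1)).filter fun i => (rungs l i F).Nonempty with hN
    have hNk : ∀ i ∈ N, i ≤ k := fun i hi =>
      Nat.lt_succ_iff.1 (Finset.mem_range.1 (Finset.mem_filter.1 hi).1)
    have h2 : (N.image b).card = N.card := by
      refine Finset.card_image_of_injOn fun i hi j hj hij => ?_
      refine hbinj i (hNk i hi) j ?_
      change b i = b j at hij
      rw [hij]
      exact (hb j (hNk j hj)).1
    have h3 : Disjoint (T₀ ∩ flat l F) (N.image b) := by
      rw [Finset.disjoint_left]
      intro e he he'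
      obtain ⟨i, hi, rfl⟩ := Finset.mem_image.1 he'
      exact hbflat i (hNk i hi) (hT₀ (Finset.mem_inter.1 he).1)
    have h4 : (T₀ ∩ flat l F) ∪ N.image b ⊆ T ∩ F := by
      refine Finset.union_subset (Finset.inter_subset_inter Finset.subset_union_left
        (Finset.filter_subset _ _)) fun e he => ?_
      obtain ⟨i, hi, rfl⟩ := Finset.mem_image.1 he
      obtain ⟨e, he⟩ := (Finset.mem_filter.1 hi).2
      have hik := hNk i hi
      refine Finset.mem_inter.2 ⟨hmemb i hik, ?_⟩
      exact hF.2 e (Finset.filter_subset _ _ he) (b i)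
        (Finset.filter_subset _ _ (hb i hik).1)
        ((hb i hik).2 e (Finset.filter_subset_filter _ hF.1 he))
    have h5 := Finset.card_le_card h4
    rw [Finset.card_union_of_disjoint h3, h2] at h5
    rw [levelRank, ← hN]
    omega

end IsLevelPoint

theorem exists_greedy_spanningTree {G : SimpleGraph V} (hG : G.Connected) (w : Sym2 V → ℝ) :
    ∃ T, IsSpanningTree G T ∧ ∀ F, IsUpper w G.edgeFinset F → edgeRank F ≤ (T ∩ F).card := by
  obtain ⟨T, hT, hc, hs, hup⟩ := exists_greedy_basis w G.edgeFinset
  have := hG.nonempty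
  refine ⟨T, isSpanningTree_of_linked hT (fun a b => hs ?_) hc, hup⟩
  apply linked_of_reachable
  rw [SimpleGraph.coe_edgeFinset, SimpleGraph.fromEdgeSet_edgeSet]
  exact hG.preconnected a b

/-! ### The spanning tree polytope -/

theorem isLinearMap_sum (F : Finset (Sym2 V)) :
    IsLinearMap ℝ fun x : Sym2 V → ℝ => ∑ e ∈ F, x e :=
  ⟨fun x y => by simp [Finset.sum_add_distrib], fun c x => by simp [Finset.mul_sum]⟩

theorem sum_chi (T F : Finset (Sym2 V)) : ∑ e ∈ F, chi T e = ((T ∩ F).card : ℝ) := by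
  simp only [chi]
  rw [Finset.sum_boole, Finset.filter_mem_eq_inter, Finset.inter_comm]

theorem IsSpanningTree.subset_edgeFinset {G : SimpleGraph V} {T : Finset (Sym2 V)}
    (hT : IsSpanningTree G T) : T ⊆ G.edgeFinset := fun _ he =>
  SimpleGraph.mem_edgeFinset.2 (hT.1 he)

theorem sum_le_edgeRank_of_mem {G : SimpleGraph V} {x : Sym2 V → ℝ}
    (hx : x ∈ spanningTreePolytope G) (F : Finset (Sym2 V)) : ∑ e ∈ F, x e ≤ edgeRank F := by
  refine convexHull_min ?_ (convex_halfSpace_le (isLinearMap_sum F) (edgeRank F : ℝ)) hx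
  rintro _ ⟨T, hT, rfl⟩
  change ∑ e ∈ F, chi T e ≤ _
  rw [sum_chi]
  exact_mod_cast hT.card_inter_le F

theorem nonneg_of_mem {G : SimpleGraph V} {x : Sym2 V → ℝ}
    (hx : x ∈ spanningTreePolytope G) (e : Sym2 V) : 0 ≤ x e := by
  have := convexHull_min ?_ (convex_halfSpace_ge (isLinearMap_sum {e}) (0 : ℝ)) hx
  · simpa using this
  · rintro _ ⟨T, hT, rfl⟩
    change 0 ≤ ∑ e' ∈ {e}, chi T e'
    rw [sum_chi]
    exact Nat.cast_nonneg _

theorem eq_zero_of_mem {G : SimpleGraph V} {x : Sym2 V → ℝ}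
    (hx : x ∈ spanningTreePolytope G) {e : Sym2 V} (he : e ∉ G.edgeFinset) : x e = 0 := by
  have := convexHull_min ?_ (convex_hyperplane (isLinearMap_sum {e}) (0 : ℝ)) hx
  · simpa using this
  · rintro _ ⟨T, hT, rfl⟩
    change ∑ e' ∈ {e}, chi T e' = 0
    rw [sum_chi, Finset.inter_singleton_of_notMem fun h => he (hT.subset_edgeFinset h)]
    simp

theorem sum_edgeFinset_of_mem {G : SimpleGraph V} {x : Sym2 V → ℝ}
    (hx : x ∈ spanningTreePolytope G) :
    ∑ e ∈ G.edgeFinset, x e = (Fintype.card V : ℝ) - 1 := by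
  refine convexHull_min ?_ (convex_hyperplane (isLinearMap_sum G.edgeFinset)
    ((Fintype.card V : ℝ) - 1)) hx
  rintro _ ⟨T, hT, rfl⟩
  change ∑ e ∈ G.edgeFinset, chi T e = _
  rw [sum_chi, Finset.inter_eq_left.2 hT.subset_edgeFinset, ← hT.card_add_one]
  simp

theorem isCompact_convexHull_chi (p : Finset (Sym2 V) → Prop) :
    IsCompact (convexHull ℝ {x : Sym2 V → ℝ | ∃ T, p T ∧ x = chi T}) := by
  refine Set.Finite.isCompact_convexHull ℝ ((Set.finite_range (chi (V := V))).subset ?_)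
  rintro _ ⟨T, -, rfl⟩
  exact ⟨T, rfl⟩

open scoped Pointwise in
theorem IsLevelPoint.exists_decomposition {G : SimpleGraph V} (hG : G.Connected) {l : V → ℕ}
    {k : ℕ} {x : Sym2 V → ℝ} {lam : ℝ} (hx : IsLevelPoint G l k x lam)
    (hxG : x ∈ spanningTreePolytope G) {Vc : ℕ → Finset V} (hVc : ∀ i ≤ k, Vc i = lower l i) :
    ∃ y ∈ gaoPolytope G Vc k, ∃ x' ∈ spanningTreePolytope G,
      x = fun e => lam * y e + (1 - lam) * x' e := by
  have := hG.nonempty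
  set K : Set (Sym2 V → ℝ) :=
    lam • gaoPolytope G Vc k + (1 - lam) • spanningTreePolytope G with hK
  suffices hxK : x ∈ K by
    obtain ⟨_, ⟨y, hy, rfl⟩, _, ⟨x', hx', rfl⟩, rfl⟩ := Set.mem_add.1 hxK
    exact ⟨y, hy, x', hx', rfl⟩
  have hcompact : IsCompact K :=
    ((isCompact_convexHull_chi _).smul lam).add ((isCompact_convexHull_chi _).smul (1 - lam))
  have hconvex : Convex ℝ K := ((convex_convexHull ℝ _).smul lam).add
    ((convex_convexHull ℝ _).smul (1 - lam))
  by_contra hxK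
  obtain ⟨f, u, hu, hfu⟩ := geometric_hahn_banach_closed_point hconvex hcompact.isClosed hxK
  set w : Sym2 V → ℝ := fun e => f (Pi.single e 1) with hw
  have hf : ∀ z, f z = ∑ e, w e * z e := by
    intro z
    have := LinearMap.pi_apply_eq_sum_univ f.toLinearMap z
    simp only [ContinuousLinearMap.coe_coe, smul_eq_mul] at this
    rw [this]
    refine Finset.sum_congr rfl fun e _ => ?_
    rw [mul_comm, hw]
    congr 2
    ext e'
    simp [Pi.single_apply, eq_comm]
  obtain ⟨S, hS, hScut, hSup⟩ := hx.exists_greedy_gaoTree w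
  obtain ⟨T, hT, hTup⟩ := exists_greedy_spanningTree hG w
  have hmem : lam • chi S + (1 - lam) • chi T ∈ K := by
    refine Set.add_mem_add ⟨_, subset_convexHull ℝ _ ⟨S, ⟨hS, fun i hi => ?_⟩, rfl⟩, rfl⟩
      ⟨_, subset_convexHull ℝ _ ⟨T, hT, rfl⟩, rfl⟩
    rw [hVc i hi]
    exact hScut i hi
  have hlt := (hu _ hmem).trans hfu
  set z : Sym2 V → ℝ := lam • chi S + (1 - lam) • chi T - x with hz
  have hsum : ∀ F, ∑ e ∈ F, z e =
      lam * ((S ∩ F).card : ℝ) + (1 - lam) * ((T ∩ F).card : ℝ) - ∑ e ∈ F, x e := by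
    intro F
    simp [hz, Finset.sum_add_distrib, ← Finset.mul_sum, sum_chi]
  have hsum0 : ∑ e ∈ G.edgeFinset, z e = 0 := by
    rw [hsum, sum_edgeFinset_of_mem hxG, Finset.inter_eq_left.2 hS.subset_edgeFinset,
      Finset.inter_eq_left.2 hT.subset_edgeFinset]
    have h1 : (S.card : ℝ) + 1 = Fintype.card V := by exact_mod_cast hS.card_add_one
    have h2 : (T.card : ℝ) + 1 = Fintype.card V := by exact_mod_cast hT.card_add_one
    rw [← h1, show (T.card : ℝ) = S.card by linarith]
    ring
  have hnonneg : 0 ≤ ∑ e ∈ G.edgeFinset, w e * z e := by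
    refine sum_mul_nonneg_of_upper_of_sum_eq_zero (fun F hF => ?_) hsum0
    rw [hsum, sub_nonneg]
    have h1 : (levelRank l k F : ℝ) ≤ (S ∩ F).card := by exact_mod_cast hSup F hF
    have h2 : (edgeRank F : ℝ) ≤ (T ∩ F).card := by exact_mod_cast hTup F hF
    exact (hx.sum_le hF.1).trans (add_le_add (mul_le_mul_of_nonneg_left h1 hx.lam_pos.le)
      (mul_le_mul_of_nonneg_left h2 (sub_nonneg.2 hx.lam_le_one)))
  have hz0 : ∀ e ∉ G.edgeFinset, z e = 0 := by
    intro e he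
    have h1 : e ∉ S := fun h => he (hS.subset_edgeFinset h)
    have h2 : e ∉ T := fun h => he (hT.subset_edgeFinset h)
    simp [hz, chi, h1, h2, eq_zero_of_mem hxG he]
  have hfz : f z = ∑ e ∈ G.edgeFinset, w e * z e := by
    rw [hf]
    exact (Finset.sum_subset (Finset.subset_univ _) fun e _ he => by rw [hz0 e he, mul_zero]).symm
  rw [hz, map_sub] at hfz
  linarith

/-! ### Chain-points -/

theorem sum_eq_sum_ite {G : SimpleGraph V} {F : Finset (Sym2 V)} (hF : F ⊆ G.edgeFinset)
    (x : Sym2 V → ℝ) :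
    ∑ e ∈ F, x e = ∑ e ∈ G.edgeFinset, if e ∈ F then x e else 0 := by
  rw [← Finset.sum_filter, Finset.filter_mem_eq_inter, Finset.inter_eq_right.2 hF]

theorem cutBetween_subset (G : SimpleGraph V) (S S' : Finset V) :
    cutBetween G S S' ⊆ G.edgeFinset := Finset.filter_subset _ _

theorem cut_subset (G : SimpleGraph V) (S : Finset V) : cut G S ⊆ G.edgeFinset :=
  cutBetween_subset _ _ _

theorem cut_compl (G : SimpleGraph V) (S : Finset V) : cut G Sᶜ = cut G S := by
  ext e
  induction e with | _ a b =>
  simp only [mem_cut, Finset.mem_compl]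
  tauto

theorem sum_degree_eq (G : SimpleGraph V) (S : Finset V) (x : Sym2 V → ℝ) :
    ∑ v ∈ S, ∑ e ∈ cut G {v}, x e =
      2 * ∑ e ∈ inducedEdges G S, x e + ∑ e ∈ cut G S, x e := by
  rw [sum_eq_sum_ite (inducedEdges_subset G S), sum_eq_sum_ite (cut_subset G S), Finset.mul_sum,
    ← Finset.sum_add_distrib]
  simp_rw [fun v => sum_eq_sum_ite (cut_subset G {v}) x]
  rw [Finset.sum_comm]
  refine Finset.sum_congr rfl fun e he => ?_
  induction e with | _ a b =>
  rw [SimpleGraph.mem_edgeFinset, SimpleGraph.mem_edgeSet] at he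
  have hab := he.ne
  have h : ∀ v ∈ S, (if s(a, b) ∈ cut G {v} then x s(a, b) else 0) =
      (if a = v then x s(a, b) else 0) + if b = v then x s(a, b) else 0 := by
    intro v _
    simp only [mem_cut, he, true_and, Finset.mem_singleton]
    by_cases h1 : a = v
    · have h2 : b ≠ v := fun h => hab (h1.trans h.symm)
      simp [h1, h2]
    · simp [h1]
  rw [Finset.sum_congr rfl h, Finset.sum_add_distrib, Finset.sum_ite_eq, Finset.sum_ite_eq]
  simp only [mem_cut, mem_inducedEdges, he, true_and]
  by_cases ha : a ∈ S <;> by_cases hb : b ∈ S <;> simp [ha, hb]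
  ring

theorem sum_inducedEdges_add_sum_compl (G : SimpleGraph V) (S : Finset V) (x : Sym2 V → ℝ) :
    ∑ e ∈ inducedEdges G S, x e + ∑ e ∈ inducedEdges G Sᶜ, x e + ∑ e ∈ cut G S, x e =
      ∑ e ∈ G.edgeFinset, x e := by
  rw [sum_eq_sum_ite (inducedEdges_subset G S), sum_eq_sum_ite (inducedEdges_subset G Sᶜ),
    sum_eq_sum_ite (cut_subset G S), ← Finset.sum_add_distrib, ← Finset.sum_add_distrib]
  refine Finset.sum_congr rfl fun e he => ?_
  induction e with | _ a b =>
  rw [SimpleGraph.mem_edgeFinset, SimpleGraph.mem_edgeSet] at he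
  simp only [mem_cut, mem_inducedEdges, he, true_and, Finset.mem_compl]
  by_cases ha : a ∈ S <;> by_cases hb : b ∈ S <;> simp [ha, hb]

theorem sum_cut_add_sum_cut (G : SimpleGraph V) (l : V → ℕ) (i : ℕ) (x : Sym2 V → ℝ) :
    ∑ e ∈ cut G (Finset.univ.filter fun v => l v < i), x e +
      ∑ e ∈ cut G (Finset.univ.filter fun v => l v < i + 1), x e =
    ∑ e ∈ cut G (Finset.univ.filter fun v => l v = i), x e +
      2 * ∑ e ∈ cutBetween G (Finset.univ.filter fun v => l v < i)
        (Finset.univ.filter fun v => i < l v), x e := by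
  rw [sum_eq_sum_ite (cut_subset G _), sum_eq_sum_ite (cut_subset G _),
    sum_eq_sum_ite (cut_subset G _), sum_eq_sum_ite (cutBetween_subset G _ _), Finset.mul_sum,
    ← Finset.sum_add_distrib, ← Finset.sum_add_distrib]
  refine Finset.sum_congr rfl fun e he => ?_
  induction e with | _ a b =>
  rw [SimpleGraph.mem_edgeFinset, SimpleGraph.mem_edgeSet] at he
  simp only [mem_cut, mem_cutBetween, he, true_and, Finset.mem_filter, Finset.mem_univ]
  split_ifs <;> first | omega | ring

theorem sum_cut_le {x : Sym2 V → ℝ} (hx : ∀ e, 0 ≤ x e) (G : SimpleGraph V) {S A B : Finset V}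
    (h : ∀ v, v ∈ S ↔ v ∈ B ∧ v ∉ A) :
    ∑ e ∈ cut G S, x e ≤ ∑ e ∈ cut G A, x e + ∑ e ∈ cut G B, x e := by
  have hsub : cut G S ⊆ cut G A ∪ cut G B := by
    intro e
    induction e with | _ a b =>
    simp only [Finset.mem_union, mem_cut, h]
    tauto
  have h1 := Finset.sum_le_sum_of_subset_of_nonneg hsub fun e _ _ => hx e
  have h2 := Finset.sum_union_inter (s₁ := cut G A) (s₂ := cut G B) (f := x)
  have h3 : 0 ≤ ∑ e ∈ cut G A ∩ cut G B, x e := Finset.sum_nonneg fun e _ => hx e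
  linarith

theorem sum_inducedEdges_le {G : SimpleGraph V} {x : Sym2 V → ℝ}
    (hx : x ∈ spanningTreePolytope G) {S : Finset V} (hS : S.Nonempty) :
    ∑ e ∈ inducedEdges G S, x e ≤ S.card - 1 := by
  have h1 := edgeRank_add_one_le_card hS (F := inducedEdges G S)
    fun a b h => (mem_inducedEdges.1 h).2
  have h2 : (edgeRank (inducedEdges G S) : ℝ) + 1 ≤ S.card := by exact_mod_cast h1
  linarith [sum_le_edgeRank_of_mem hx (inducedEdges G S)]

theorem sum_inducedEdges_of_sum_cut_eq_one {G : SimpleGraph V} {x : Sym2 V → ℝ}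
    (hx : x ∈ spanningTreePolytope G) {S : Finset V} (hS : S.Nonempty) (hS' : Sᶜ.Nonempty)
    (h1 : ∑ e ∈ cut G S, x e = 1) : ∑ e ∈ inducedEdges G S, x e = S.card - 1 := by
  have h2 := sum_inducedEdges_add_sum_compl G S x
  have h3 := sum_inducedEdges_le hx hS
  have h4 := sum_inducedEdges_le hx hS'
  have h5 : (S.card : ℝ) + Sᶜ.card = Fintype.card V := by
    exact_mod_cast Finset.card_add_card_compl S
  rw [sum_edgeFinset_of_mem hx] at h2
  linarith

theorem sum_cut_eq_zero {G : SimpleGraph V} {S : Finset V} (x : Sym2 V → ℝ)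
    (h : S = ∅ ∨ S = Finset.univ) : ∑ e ∈ cut G S, x e = 0 := by
  refine Finset.sum_eq_zero fun e he => ?_
  exfalso
  induction e with | _ a b =>
  rw [mem_cut] at he
  rcases h with rfl | rfl <;> simp at he

theorem isLevelPoint_of_sum_degree {G : SimpleGraph V} {l : V → ℕ} {k : ℕ} {x : Sym2 V → ℝ}
    {lam : ℝ} (hx : x ∈ spanningTreePolytope G) (hl : ∀ v, l v ≤ k + 1)
    (hl' : ∀ i ≤ k + 1, ∃ v, l v = i) (hpos : 0 < lam) (hone : lam ≤ 1)
    (hcut : ∀ i ≤ k, ∑ e ∈ cut G (lower l i), x e ≤ 2 - lam)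
    (hbot : ∑ e ∈ cut G (lower l 0), x e = 1) (htop : ∑ e ∈ cut G (lower l k), x e = 1)
    (hdeg : ∀ i, 1 ≤ i → i ≤ k → ∑ v ∈ Finset.univ.filter (fun v => l v = i),
      ∑ e ∈ cut G {v}, x e = 2 * ((Finset.univ.filter fun v => l v = i).card : ℝ)) :
    IsLevelPoint G l k x lam := by
  have hnonneg := nonneg_of_mem hx
  set L : ℕ → Finset V := fun i => Finset.univ.filter fun v => l v = i with hL
  set c : ℕ → ℝ := fun i => ∑ e ∈ cut G (Finset.univ.filter fun v => l v < i), x e with hc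
  have hc0 : c 0 = 0 := sum_cut_eq_zero x (Or.inl (by simp))
  have hclast : c (k + 2) = 0 :=
    sum_cut_eq_zero x (Or.inr (Finset.filter_true_of_mem fun v _ => Nat.lt_succ_of_le (hl v)))
  have hcsucc : ∀ i, c (i + 1) = ∑ e ∈ cut G (lower l i), x e := by
    intro i
    simp only [hc, lower, Nat.lt_succ_iff]
  have hcle : ∀ i ≤ k + 2, c i ≤ 2 - lam := by
    intro i hi
    rcases Nat.eq_zero_or_pos i with rfl | hi0
    · linarith
    obtain ⟨j, rfl⟩ := Nat.exists_eq_succ_of_ne_zero hi0.ne'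
    rcases Nat.lt_or_ge k j with hj | hj
    · rw [show j.succ = k + 2 by omega]; linarith
    · exact (hcsucc j).trans_le (hcut j hj)
  have hLne : ∀ i ≤ k + 1, (L i).Nonempty := fun i hi => by
    obtain ⟨v, hv⟩ := hl' i hi
    exact ⟨v, by simp [hL, hv]⟩
  have hLbot : L 0 = lower l 0 := by ext v; simp [hL, lower]
  have hLtop : L (k + 1) = (lower l k)ᶜ := by
    ext v
    have := hl v
    simp only [hL, Finset.mem_filter, Finset.mem_univ, true_and, Finset.mem_compl, mem_lower]
    omega
  have hEbot : ∑ e ∈ inducedEdges G (L 0), x e = (L 0).card - 1 := by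
    refine sum_inducedEdges_of_sum_cut_eq_one hx (hLne 0 (by omega)) ?_ (by rw [hLbot, hbot])
    obtain ⟨v, hv⟩ := hl' (k + 1) le_rfl
    exact ⟨v, by simp [hL, hv]⟩
  have hEtop : ∑ e ∈ inducedEdges G (L (k + 1)), x e = (L (k + 1)).card - 1 := by
    refine sum_inducedEdges_of_sum_cut_eq_one hx (hLne _ le_rfl) ?_
      (by rw [hLtop, cut_compl, htop])
    obtain ⟨v, hv⟩ := hl' 0 (by omega)
    exact ⟨v, by simp [hL, hv]⟩
  have hDbot : ∑ v ∈ L 0, ∑ e ∈ cut G {v}, x e = 2 * (L 0).card - 1 := by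
    rw [sum_degree_eq, hEbot, hLbot, hbot]; ring
  have hDtop : ∑ v ∈ L (k + 1), ∑ e ∈ cut G {v}, x e = 2 * (L (k + 1)).card - 1 := by
    rw [sum_degree_eq, hEtop, hLtop, cut_compl, htop]; ring
  refine ⟨hl, hl', hnonneg, sum_le_edgeRank_of_mem hx, hpos, hone, hcut, ?_, ?_, ?_⟩
  · intro i hi
    change ((L i).card : ℝ) - 2 + lam ≤ ∑ e ∈ inducedEdges G (L i), x e
    rcases Nat.eq_zero_or_pos i with rfl | hi0
    · linarith
    rcases Nat.lt_or_ge k i with hik | hik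
    · rw [show i = k + 1 by omega]; linarith
    have h1 := hdeg i hi0 hik
    change ∑ v ∈ L i, _ = 2 * ((L i).card : ℝ) at h1
    rw [sum_degree_eq] at h1
    have h2 : ∑ e ∈ cut G (L i), x e ≤ c i + c (i + 1) := by
      refine sum_cut_le hnonneg G fun v => ?_
      simp only [hL, Finset.mem_filter, Finset.mem_univ, true_and]
      omega
    linarith [hcle i (by omega), hcle (i + 1) (by omega)]
  · intro i hi
    have hS : (Finset.univ.filter fun v => l v = i ∨ l v = i + 1) = L i ∪ L (i + 1) := by
      ext v; simp [hL]
    have hdisj : Disjoint (L i) (L (i + 1)) := by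
      rw [Finset.disjoint_left]
      intro v
      simp only [hL, Finset.mem_filter, Finset.mem_univ, true_and]
      omega
    have h1 : ∑ e ∈ cut G (L i ∪ L (i + 1)), x e ≤ c i + c (i + 2) := by
      refine sum_cut_le hnonneg G fun v => ?_
      simp only [hL, Finset.mem_union, Finset.mem_filter, Finset.mem_univ, true_and]
      omega
    have h2 := sum_degree_eq G (L i ∪ L (i + 1)) x
    rw [Finset.sum_union hdisj] at h2
    rw [hS, Finset.card_union_of_disjoint hdisj]
    push_cast
    rcases Nat.eq_zero_or_pos i with rfl | hi0
    · rcases Nat.eq_zero_or_pos k with rfl | hk0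
      · linarith
      · have h3 := hdeg 1 le_rfl hk0
        change ∑ v ∈ L (0 + 1), _ = 2 * ((L (0 + 1)).card : ℝ) at h3
        linarith [hcle (0 + 2) (by omega)]
    have h3 := hdeg i hi0 hi
    change ∑ v ∈ L i, _ = 2 * ((L i).card : ℝ) at h3
    rcases hi.eq_or_lt with rfl | hik
    · linarith [hcle i (by omega)]
    · have h4 := hdeg (i + 1) (by omega) hik
      change ∑ v ∈ L (i + 1), _ = 2 * ((L (i + 1)).card : ℝ) at h4
      linarith [hcle i (by omega), hcle (i + 2) (by omega)]
  · intro i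
    by_cases hi : 1 ≤ i ∧ i ≤ k
    · have h1 := sum_cut_add_sum_cut G l i x
      change c i + c (i + 1) = ∑ e ∈ cut G (L i), x e + _ at h1
      have h2 := hdeg i hi.1 hi.2
      change ∑ v ∈ L i, _ = 2 * ((L i).card : ℝ) at h2
      rw [sum_degree_eq] at h2
      have h3 := sum_inducedEdges_le hx (hLne i (by omega))
      linarith [hcle i (by omega), hcle (i + 1) (by omega)]
    · refine le_of_eq_of_le (Finset.sum_eq_zero fun e he => ?_) (sub_nonneg.2 hone)
      exfalso
      induction e with | _ a b =>
      rw [mem_cutBetween] at he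
      simp only [Finset.mem_filter, Finset.mem_univ, true_and] at he
      have := hl a
      have := hl b
      omega

/-- The index of the level containing `v`. -/
noncomputable def levelIndex (Vc : ℕ → Finset V) (k : ℕ) (v : V) : ℕ :=
  ((Finset.range (k + 1)).filter fun i => v ∉ Vc i).card

theorem levelIndex_le_add_one (Vc : ℕ → Finset V) (k : ℕ) (v : V) :
    levelIndex Vc k v ≤ k + 1 :=
  (Finset.card_filter_le _ _).trans (Finset.card_range _).le

section Chain

variable {Vc : ℕ → Finset V} {k : ℕ}

theorem chain_mono (hchain : ∀ i < k, Vc i ⊂ Vc (i + 1)) {i j : ℕ}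
    (hij : i ≤ j) (hj : j ≤ k) : Vc i ⊆ Vc j := by
  induction j, hij using Nat.le_induction with
  | base => exact subset_rfl
  | succ j _ ih => exact (ih (by omega)).trans (hchain j (by omega)).1

theorem mem_chain_iff (hchain : ∀ i < k, Vc i ⊂ Vc (i + 1)) {i : ℕ}
    (hi : i ≤ k) (v : V) : v ∈ Vc i ↔ levelIndex Vc k v ≤ i := by
  constructor
  · intro hv
    have : (Finset.range (k + 1)).filter (fun i => v ∉ Vc i) ⊆ Finset.range i := by
      intro j hj
      rw [Finset.mem_filter, Finset.mem_range] at hj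
      rw [Finset.mem_range]
      by_contra hij
      exact hj.2 (chain_mono hchain (not_lt.1 hij) (by omega) hv)
    exact (Finset.card_le_card this).trans (Finset.card_range i).le
  · intro hv
    by_contra hn
    have : Finset.range (i + 1) ⊆ (Finset.range (k + 1)).filter (fun i => v ∉ Vc i) := by
      intro j hj
      rw [Finset.mem_range] at hj
      rw [Finset.mem_filter, Finset.mem_range]
      exact ⟨by omega, fun h => hn (chain_mono hchain (by omega) hi h)⟩
    have := Finset.card_le_card this
    rw [Finset.card_range] at this
    unfold levelIndex at hv
    omega

theorem chain_eq_lower (hchain : ∀ i < k, Vc i ⊂ Vc (i + 1)) {i : ℕ}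
    (hi : i ≤ k) : Vc i = lower (levelIndex Vc k) i := by
  ext v
  rw [mem_lower, mem_chain_iff hchain hi]

theorem exists_levelIndex_eq (hchain : ∀ i < k, Vc i ⊂ Vc (i + 1))
    (hne : (Vc 0).Nonempty) (htop : Vc k ⊂ Finset.univ) {i : ℕ}
    (hi : i ≤ k + 1) : ∃ v, levelIndex Vc k v = i := by
  rcases Nat.eq_zero_or_pos i with rfl | hi0
  · obtain ⟨v, hv⟩ := hne
    exact ⟨v, Nat.le_zero.1 ((mem_chain_iff hchain (by omega) v).1 hv)⟩
  obtain ⟨j, rfl⟩ := Nat.exists_eq_succ_of_ne_zero hi0.ne'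
  rcases Nat.lt_or_ge j k with hj | hj
  · obtain ⟨v, hv, hv'⟩ := Finset.exists_of_ssubset (hchain j hj)
    rw [mem_chain_iff hchain (by omega)] at hv hv'
    exact ⟨v, by omega⟩
  · obtain ⟨v, -, hv⟩ := Finset.exists_of_ssubset htop
    rw [mem_chain_iff hchain le_rfl] at hv
    have := levelIndex_le_add_one Vc k v
    exact ⟨v, by omega⟩

theorem level_eq_filter (hchain : ∀ i < k, Vc i ⊂ Vc (i + 1)) {i : ℕ}
    (hi : 1 ≤ i) (hik : i ≤ k) :
    level Vc k i = Finset.univ.filter fun v => levelIndex Vc k v = i := by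
  ext v
  rw [level, if_neg (by omega), if_pos hik, Finset.mem_sdiff, mem_chain_iff hchain hik,
    mem_chain_iff hchain (by omega), Finset.mem_filter]
  simp only [Finset.mem_univ, true_and]
  omega

end Chain

theorem stmt0 (G : SimpleGraph V) (hG : G.Connected)
    (Vc : ℕ → Finset V) (k : ℕ)
    (hne : (Vc 0).Nonempty) (hchain : ∀ i < k, Vc i ⊂ Vc (i + 1))
    (htop : Vc k ⊂ Finset.univ)
    (x : Sym2 V → ℝ) (hx : IsChainPoint G Vc k x)
    (lam : ℝ)
    (hlam : lam = 2 - (Finset.range (k + 1)).sup'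
      (Finset.nonempty_range_iff.mpr (Nat.succ_ne_zero k))
      (fun i => ∑ e ∈ cut G (Vc i), x e)) :
    ∃ y ∈ gaoPolytope G Vc k, ∃ x' ∈ spanningTreePolytope G,
      x = fun e => lam * y e + (1 - lam) * x' e := by
  obtain ⟨hxG, hx0, hxk, hx2, hxd⟩ := hx
  have hle : ∀ i ≤ k, ∑ e ∈ cut G (Vc i), x e ≤ 2 - lam := by
    intro i hi
    rw [hlam, sub_sub_cancel]
    exact Finset.le_sup' (fun i => ∑ e ∈ cut G (Vc i), x e) (Finset.mem_range.2 (by omega))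
  have hpos : 0 < lam := by
    rw [hlam, sub_pos, Finset.sup'_lt_iff]
    intro i hi
    rw [Finset.mem_range] at hi
    rcases Nat.eq_zero_or_pos i with rfl | hi0
    · rw [hx0]; norm_num
    rcases Nat.lt_or_ge i k with hik | hik
    · exact hx2 i hi0 (by omega)
    · rw [show i = k by omega, hxk]; norm_num
  have hone : lam ≤ 1 := by linarith [hle 0 (by omega)]
  have hVc : ∀ i ≤ k, Vc i = lower (levelIndex Vc k) i := fun i hi => chain_eq_lower hchain hi
  refine (isLevelPoint_of_sum_degree hxG (levelIndex_le_add_one Vc k)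
    (fun i hi => exists_levelIndex_eq hchain hne htop hi) hpos hone
    (fun i hi => hVc i hi ▸ hle i hi) (hVc 0 (Nat.zero_le k) ▸ hx0) (hVc k le_rfl ▸ hxk)
    fun i hi hik => ?_).exists_decomposition hG hxG hVc
  rw [← level_eq_filter hchain hi hik]
  exact hxd i hi hik
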